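/- Fix an integer r ≥ 1. For every real ε > 0 there exists N such that every integer n ≥ 2 with ω(n) ≥ N satisfies |K(C_n^r)/ω(n) − r| < ε, where C_n^r denotes the direct sum of r copies of C_n. -/

import Mathlib

open scoped BigOperators

attribute [local instance] Classical.propDecidable

/-- A sequence (multiset) over `G` is zero-sumfree if no nonempty sub-multiset sums to `0`. -/
def IsZeroSumFree {G : Type*} [AddCommGroup G] (S : Multiset G) : Prop :=
  ∀ T : Multiset G, T ≤ S → T ≠ 0 → T.sum ≠ 0

/-- A minimal zero-sum sequence: sum `0`, and no nonempty proper sub-multiset sums to `0`. -/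
def IsMinimalZeroSum {G : Type*} [AddCommGroup G] (S : Multiset G) : Prop :=
  S.sum = 0 ∧ ∀ T : Multiset G, T < S → T ≠ 0 → T.sum ≠ 0

/-- The cross number of a sequence: `k(S) = Σ_{g ∈ S} 1/ord(g)`. -/
noncomputable def crossNumber {G : Type*} [AddCommGroup G] (S : Multiset G) : ℝ :=
  (S.map fun g => (1 : ℝ) / (addOrderOf g)).sum

/-- The little cross number `k(G)`: max of `k(S)` over zero-sumfree sequences `S` over `G`. -/
noncomputable def littleCrossNumber (G : Type*) [AddCommGroup G] : ℝ :=
  sSup {x : ℝ | ∃ S : Multiset G, IsZeroSumFree S ∧ crossNumber S = x}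

/-- The cross number `K(G)`: max of `k(S)` over minimal zero-sum sequences `S` over `G`. -/
noncomputable def bigCrossNumber (G : Type*) [AddCommGroup G] : ℝ :=
  sSup {x : ℝ | ∃ S : Multiset G, IsMinimalZeroSum S ∧ crossNumber S = x}

/-- The Davenport constant `D(G)`. -/
noncomputable def davenport (G : Type*) [AddCommGroup G] : ℕ :=
  sInf {t | 1 ≤ t ∧ ∀ S : Multiset G, t ≤ Multiset.card S →
    ∃ T, T ≤ S ∧ T ≠ 0 ∧ T.sum = 0}

/-- The constant `η(G)`. -/
noncomputable def etaConst (G : Type*) [AddCommGroup G] : ℕ :=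
  sInf {t | 1 ≤ t ∧ ∀ S : Multiset G, t ≤ Multiset.card S →
    ∃ T, T ≤ S ∧ T ≠ 0 ∧ Multiset.card T ≤ AddMonoid.exponent G ∧ T.sum = 0}

/-- `υ_i(d',d) = A_i / gcd(A_i, B_i)` where `A_i = gcd(d', n_i)` and
`B_i = lcm(d, n_i)/lcm(d', n_i)`. -/
def upsilon (ni d' d : ℕ) : ℕ :=
  Nat.gcd d' ni / Nat.gcd (Nat.gcd d' ni) (Nat.lcm d ni / Nat.lcm d' ni)

/-- `k*` of `C_{n_1} ⊕ ... ⊕ C_{n_r}`, computed from the primary decomposition. -/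
noncomputable def kStarTuple {r : ℕ} (n : Fin r → ℕ) : ℝ :=
  ∑ i, ∑ p ∈ (n i).primeFactors,
    ((p ^ ((n i).factorization p) : ℝ) - 1) / (p ^ ((n i).factorization p))

/-- `α(n) = Σ_{d | n} (P⁻(d) − 1)/d`. -/
noncomputable def alphaFn (n : ℕ) : ℝ :=
  ∑ d ∈ n.divisors, ((d.minFac : ℝ) - 1) / d

/-- `β(n) = Σ_{p | n prime} (p − 1)/p`. -/
noncomputable def betaFn (n : ℕ) : ℝ :=
  ∑ p ∈ n.primeFactors, ((p : ℝ) - 1) / p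

section Shift

variable {V : Type*} [AddCommGroup V]

/-- The number of elements of `A` that leave `A` under translation by `x`. -/
noncomputable def shiftDefect (A : Finset V) (x : V) : ℕ := (A.filter fun a => a + x ∉ A).card

/-- The number of elements of `A` that stay in `A` under translation by `x`. -/
noncomputable def shiftOverlap (A : Finset V) (x : V) : ℕ := (A.filter fun a => a + x ∈ A).card

lemma shiftOverlap_add_shiftDefect (A : Finset V) (x : V) :
    shiftOverlap A x + shiftDefect A x = A.card :=
  Finset.card_filter_add_card_filter_not _

lemma shiftDefect_zero (A : Finset V) : shiftDefect A 0 = 0 := by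
  simp [shiftDefect]

lemma shiftDefect_add_le (A : Finset V) (x y : V) :
    shiftDefect A (x + y) ≤ shiftDefect A x + shiftDefect A y := by
  have h : (A.filter fun a => a + (x + y) ∉ A) ⊆ (A.filter fun a => a + x ∉ A) ∪
      (A.filter fun a => a + y ∉ A).image fun b => b - x := by
    intro a ha
    simp only [Finset.mem_filter, Finset.mem_union, Finset.mem_image] at ha ⊢
    by_cases hx : a + x ∈ A
    · exact Or.inr ⟨a + x, ⟨hx, by rw [add_assoc]; exact ha.2⟩, by abel⟩
    · exact Or.inl ⟨ha.1, hx⟩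
  exact (Finset.card_le_card h).trans ((Finset.card_union_le _ _).trans
    (Nat.add_le_add_left Finset.card_image_le _))

lemma shiftDefect_nsmul_le (A : Finset V) (x : V) (j : ℕ) :
    shiftDefect A (j • x) ≤ j * shiftDefect A x := by
  induction j with
  | zero => simp [shiftDefect_zero]
  | succ j ih =>
    rw [succ_nsmul, add_mul, one_mul]
    exact (shiftDefect_add_le A _ _).trans (by gcongr)

lemma card_union_image_add (A : Finset V) (x : V) :
    (A ∪ A.image fun a => a + x).card = A.card + shiftDefect A x := by
  rw [← Finset.union_sdiff_self_eq_union, Finset.card_union_of_disjoint Finset.disjoint_sdiff]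
  congr 1
  have : (A.image fun a => a + x) \ A = (A.filter fun a => a + x ∉ A).image fun a => a + x := by
    ext b
    simp only [Finset.mem_sdiff, Finset.mem_image, Finset.mem_filter]
    constructor
    · rintro ⟨⟨a, ha, rfl⟩, h⟩
      exact ⟨a, ⟨ha, h⟩, rfl⟩
    · rintro ⟨a, ⟨ha, h⟩, rfl⟩
      exact ⟨⟨a, ha, rfl⟩, h⟩
  rw [this, Finset.card_image_of_injective _ (add_left_injective x)]
  rfl

/-- Translates of `A` by distinct elements cover each element of `A` at most `A.card` times. -/
lemma sum_shiftOverlap_le (A B : Finset V) : ∑ x ∈ B, shiftOverlap A x ≤ A.card * A.card := by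
  have h : ∀ x ∈ B, shiftOverlap A x = ∑ a ∈ A, if a + x ∈ A then 1 else 0 := fun x _ => by
    rw [shiftOverlap, Finset.card_filter]
  rw [Finset.sum_congr rfl h, Finset.sum_comm, ← smul_eq_mul]
  refine Finset.sum_le_card_nsmul _ _ _ fun a _ => ?_
  rw [← Finset.card_filter]
  refine Finset.card_le_card_of_injOn (fun x => a + x) (fun x hx => ?_)
    (add_right_injective a).injOn
  exact (Finset.mem_filter.1 hx).2

end Shift

section Fourier

variable {V : Type*} [AddCommGroup V] [Fintype V] {ι : Type*}

lemma normSq_sum_addChar (ψ : AddChar V ℂ) (I : Finset ι) (g : ι → V) :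
    ((Complex.normSq (∑ i ∈ I, ψ (g i)) : ℝ) : ℂ) = ∑ i ∈ I, ∑ i' ∈ I, ψ (g i - g i') := by
  rw [Complex.normSq_eq_conj_mul_self, mul_comm, map_sum, Finset.sum_mul_sum]
  refine Finset.sum_congr rfl fun i _ => Finset.sum_congr rfl fun i' _ => ?_
  rw [← AddChar.map_neg_eq_conj, ← AddChar.map_add_eq_mul, sub_eq_add_neg]

lemma sum_normSq_sum_addChar (I : Finset ι) (g : ι → V) :
    ∑ ψ : AddChar V ℂ, Complex.normSq (∑ i ∈ I, ψ (g i)) =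
      Fintype.card V * ∑ i ∈ I, ∑ i' ∈ I, if g i = g i' then (1 : ℝ) else 0 := by
  have : ((∑ ψ : AddChar V ℂ, Complex.normSq (∑ i ∈ I, ψ (g i)) : ℝ) : ℂ) =
      ((Fintype.card V * ∑ i ∈ I, ∑ i' ∈ I, if g i = g i' then (1 : ℝ) else 0 : ℝ) : ℂ) := by
    push_cast
    simp_rw [normSq_sum_addChar]
    rw [Finset.sum_comm, Finset.mul_sum]
    refine Finset.sum_congr rfl fun i _ => ?_
    rw [Finset.sum_comm, Finset.mul_sum]
    refine Finset.sum_congr rfl fun i' _ => ?_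
    rw [AddChar.sum_apply_eq_ite]
    simp only [sub_eq_zero]
    split_ifs <;> simp
  exact_mod_cast this

lemma sum_range_normSq_sum_addChar {p : ℕ} (hV : ∀ x : V, p • x = 0) (ψ : AddChar V ℂ)
    (I : Finset ι) (f : ι → V) :
    ∑ j ∈ Finset.range p, Complex.normSq (∑ i ∈ I, ψ (j • f i)) =
      p * ∑ i ∈ I, ∑ i' ∈ I, if ψ (f i) = ψ (f i') then (1 : ℝ) else 0 := by
  have key : ∀ x : V, ∑ j ∈ Finset.range p, ψ (j • x) = if ψ x = 1 then (p : ℂ) else 0 := by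
    intro x
    simp_rw [AddChar.map_nsmul_eq_pow]
    split_ifs with h
    · simp [h]
    · have h1 : (ψ x - 1) * ∑ j ∈ Finset.range p, ψ x ^ j = 0 := by
        rw [mul_comm, geom_sum_mul, ← AddChar.map_nsmul_eq_pow, hV, AddChar.map_zero_eq_one,
          sub_self]
      exact (mul_eq_zero.1 h1).resolve_left (sub_ne_zero.2 h)
  have : ((∑ j ∈ Finset.range p, Complex.normSq (∑ i ∈ I, ψ (j • f i)) : ℝ) : ℂ) =
      ((p * ∑ i ∈ I, ∑ i' ∈ I, if ψ (f i) = ψ (f i') then (1 : ℝ) else 0 : ℝ) : ℂ) := by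
    push_cast
    simp_rw [normSq_sum_addChar]
    rw [Finset.sum_comm, Finset.mul_sum]
    refine Finset.sum_congr rfl fun i _ => ?_
    rw [Finset.sum_comm, Finset.mul_sum]
    refine Finset.sum_congr rfl fun i' _ => ?_
    simp_rw [← smul_sub]
    rw [key]
    simp only [AddChar.map_sub_eq_div, div_eq_one_iff_eq (ψ.val_isUnit _).ne_zero]
    split_ifs <;> simp
  exact_mod_cast this

lemma sum_normSq_mul_normSq (A : Finset V) (I : Finset ι) (f : ι → V) (j : ℕ) :
    ∑ ψ : AddChar V ℂ, Complex.normSq (∑ a ∈ A, ψ a) * Complex.normSq (∑ i ∈ I, ψ (j • f i)) =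
      Fintype.card V * ∑ i ∈ I, ∑ i' ∈ I, (shiftOverlap A (j • (f i - f i')) : ℝ) := by
  have h := sum_normSq_sum_addChar (A ×ˢ I) fun q : V × ι => q.1 + j • f q.2
  have h1 : ∀ ψ : AddChar V ℂ, Complex.normSq (∑ q ∈ A ×ˢ I, ψ (q.1 + j • f q.2)) =
      Complex.normSq (∑ a ∈ A, ψ a) * Complex.normSq (∑ i ∈ I, ψ (j • f i)) := by
    intro ψ
    rw [← Complex.normSq_mul, Finset.sum_mul_sum, Finset.sum_product]
    simp_rw [AddChar.map_add_eq_mul]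
  simp_rw [h1] at h
  rw [h]
  congr 1
  rw [Finset.sum_product_right]
  refine Finset.sum_congr rfl fun i _ => ?_
  simp_rw [Finset.sum_product_right]
  rw [Finset.sum_comm]
  refine Finset.sum_congr rfl fun i' _ => ?_
  rw [shiftOverlap, Finset.card_filter]
  push_cast
  refine Finset.sum_congr rfl fun a _ => ?_
  rw [← Finset.sum_ite_eq A (a + j • (f i - f i')) fun _ => (1 : ℝ)]
  refine Finset.sum_congr rfl fun b _ => ?_
  congr 1
  rw [smul_sub, eq_iff_iff]
  constructor <;> intro h
  · rw [← add_sub_assoc, h]; abel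
  · rw [← h]; abel

lemma sum_shiftOverlap_differences_le {p k : ℕ} (hV : ∀ x : V, p • x = 0) (hkp : k ≤ p)
    (A : Finset V) (I : Finset ι) (f : ι → V) {L : ℝ} (hL₀ : 0 ≤ L)
    (hL : ∀ ψ : AddChar V ℂ, ψ ≠ 0 → ∀ i ∈ I,
      ((I.filter fun i' => ψ (f i) = ψ (f i')).card : ℝ) ≤ L) :
    Fintype.card V * ∑ j ∈ Finset.range k, ∑ i ∈ I, ∑ i' ∈ I,
        (shiftOverlap A (j • (f i - f i')) : ℝ) ≤
      (A.card : ℝ) ^ 2 * (k * (I.card : ℝ) ^ 2) +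
        Fintype.card V * A.card * (p * (I.card * L)) := by
  rw [Finset.mul_sum]
  simp_rw [← sum_normSq_mul_normSq]
  rw [Finset.sum_comm]
  simp_rw [← Finset.mul_sum]
  rw [← Finset.add_sum_erase _ _ (Finset.mem_univ (0 : AddChar V ℂ))]
  refine add_le_add (le_of_eq ?_) ?_
  · simp [Complex.normSq_natCast]
    ring
  · have hA := sum_normSq_sum_addChar A (fun a : V => a)
    have hA' : ∑ a ∈ A, ∑ a' ∈ A, (if a = a' then (1 : ℝ) else 0) = A.card := by
      simp [Finset.sum_ite_eq]
    rw [hA'] at hA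
    rw [← hA, Finset.sum_mul]
    refine (Finset.sum_le_sum fun ψ hψ => ?_).trans
      (Finset.sum_le_sum_of_subset_of_nonneg (Finset.erase_subset _ _) fun ψ _ _ => ?_)
    · refine mul_le_mul_of_nonneg_left ?_ (Complex.normSq_nonneg _)
      refine (Finset.sum_le_sum_of_subset_of_nonneg (Finset.range_subset_range.2 hkp)
        fun _ _ _ => Complex.normSq_nonneg _).trans ?_
      rw [sum_range_normSq_sum_addChar hV]
      refine mul_le_mul_of_nonneg_left ?_ (Nat.cast_nonneg _)
      rw [← nsmul_eq_mul]
      refine Finset.sum_le_card_nsmul _ _ _ fun i hi => ?_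
      rw [← Finset.sum_filter, Finset.sum_const, nsmul_eq_mul, mul_one]
      exact hL ψ (Finset.ne_of_mem_erase hψ) i hi
    · refine mul_nonneg (Complex.normSq_nonneg _) ?_
      positivity

end Fourier

section Growth

variable {V : Type*} [AddCommGroup V] {ι : Type*}

lemma card_sup_zmultiples_le {p : ℕ} (hp : 0 < p) [Finite V] {v : V} (hv : p • v = 0)
    (H : AddSubgroup V) :
    Nat.card (H ⊔ AddSubgroup.zmultiples v : AddSubgroup V) ≤ Nat.card H * p := by
  have hle : Nat.card (AddSubgroup.zmultiples v) ≤ p := by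
    rw [Nat.card_zmultiples]
    exact Nat.le_of_dvd hp (addOrderOf_dvd_of_nsmul_eq_zero hv)
  refine le_trans ?_ (Nat.mul_le_mul_left _ hle)
  rw [← Nat.card_prod]
  refine Nat.card_le_card_of_surjective
    (fun q : H × AddSubgroup.zmultiples v => (⟨q.1 + q.2, AddSubgroup.add_mem_sup q.1.2 q.2.2⟩ :
      (H ⊔ AddSubgroup.zmultiples v : AddSubgroup V))) ?_
  rintro ⟨x, hx⟩
  obtain ⟨a, ha, b, hb, rfl⟩ := AddSubgroup.mem_sup.1 hx
  exact ⟨(⟨a, ha⟩, ⟨b, hb⟩), rfl⟩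

lemma prime_nsmul_injOn {p k : ℕ} (hp : p.Prime) (hkp : k ≤ p) {v : V} (hv : p • v = 0)
    {H : AddSubgroup V} (hvH : v ∉ H) {i j : ℕ} (hi : i < k) (hj : j < k) {x y : V}
    (hx : x ∈ H) (hy : y ∈ H) (h : x + i • v = y + j • v) : i = j := by
  wlog hij : i ≤ j generalizing i j x y
  · exact (this hj hi hy hx h.symm (le_of_not_ge hij)).symm
  by_contra hne
  have hmem : (j - i) • v ∈ H := by
    rw [sub_nsmul _ hij, ← sub_eq_add_neg, show j • v - i • v = x - y by
      rw [sub_eq_sub_iff_add_eq_add, add_comm, ← h]]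
    exact H.sub_mem hx hy
  have hcop : Nat.Coprime (j - i) p :=
    (Nat.coprime_of_lt_prime (by omega) (by omega) hp).symm
  have hbez := Nat.gcd_eq_gcd_ab (j - i) p
  rw [hcop.gcd_eq_one] at hbez
  apply hvH
  have : v = (Nat.gcdA (j - i) p) • ((j - i) • v) := by
    conv_lhs => rw [← one_zsmul v, show (1 : ℤ) = ((1 : ℕ) : ℤ) from rfl, hbez, add_zsmul]
    rw [mul_zsmul', mul_zsmul', natCast_zsmul, natCast_zsmul, hv]
    simp
  rw [this]
  exact H.zsmul_mem hmem _

/-- If all differences of a family generating `V` translate `A` almost into itself, then so do all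
elements of a large box. -/
lemma exists_box {p k r : ℕ} (hp : p.Prime) (hkp : k ≤ p) [Finite V] (hV : ∀ x : V, p • x = 0)
    (hcard : p ^ r < Nat.card V) (A : Finset V) (I : Finset ι) (f : ι → V)
    (hspread : ∀ H : AddSubgroup V, H ≠ ⊤ → ∃ i ∈ I, ∃ i' ∈ I, f i - f i' ∉ H) {D : ℕ}
    (hD : ∀ i ∈ I, ∀ i' ∈ I, shiftDefect A (f i - f i') ≤ D) (n : ℕ) (hn : n ≤ r + 1) :
    ∃ (H : AddSubgroup V) (B : Finset V), Nat.card H ≤ p ^ n ∧ (∀ x ∈ B, x ∈ H) ∧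
      B.card = k ^ n ∧ ∀ x ∈ B, shiftDefect A x ≤ n * k * D := by
  induction n with
  | zero => exact ⟨⊥, {0}, by simp, by simp, by simp, by simp [shiftDefect_zero]⟩
  | succ n ih =>
    obtain ⟨H, B, hH, hBH, hB, hBD⟩ := ih (by omega)
    have hHtop : H ≠ ⊤ := by
      rintro rfl
      rw [AddSubgroup.card_top] at hH
      have := Nat.pow_le_pow_right hp.pos (show n ≤ r by omega)
      omega
    obtain ⟨i, hi, i', hi', hv⟩ := hspread H hHtop
    set v := f i - f i' with hvdef
    refine ⟨H ⊔ AddSubgroup.zmultiples v,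
      (B ×ˢ Finset.range k).image fun q => q.1 + q.2 • v, ?_, ?_, ?_, ?_⟩
    · rw [pow_succ]
      exact (card_sup_zmultiples_le hp.pos (hV v) H).trans (Nat.mul_le_mul_right _ hH)
    · intro x hx
      obtain ⟨q, hq, rfl⟩ := Finset.mem_image.1 hx
      exact AddSubgroup.add_mem_sup (hBH _ (Finset.mem_product.1 hq).1)
        (AddSubgroup.nsmul_mem_zmultiples v q.2)
    · rw [Finset.card_image_of_injOn, Finset.card_product, hB, Finset.card_range, pow_succ]
      rintro ⟨x, s⟩ hx ⟨y, t⟩ hy h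
      simp only [Finset.coe_product, Set.mem_prod, Finset.mem_coe, Finset.mem_range] at hx hy h
      have hst := prime_nsmul_injOn hp hkp (hV v) hv hx.2 hy.2 (hBH _ hx.1) (hBH _ hy.1) h
      subst hst
      simpa using h
    · intro x hx
      obtain ⟨q, hq, rfl⟩ := Finset.mem_image.1 hx
      rw [Finset.mem_product, Finset.mem_range] at hq
      calc shiftDefect A (q.1 + q.2 • v) ≤ n * k * D + q.2 * D :=
            (shiftDefect_add_le _ _ _).trans (add_le_add (hBD _ hq.1)
              ((shiftDefect_nsmul_le _ _ _).trans (Nat.mul_le_mul_left _ (hD i hi i' hi'))))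
        _ ≤ n * k * D + k * D := by gcongr; exact hq.2.le
        _ = (n + 1) * k * D := by ring

/-- Growth of small sets. -/
lemma exists_shiftDefect_of_small {p k r : ℕ} (hp : p.Prime) (hk : 0 < k) (hkp : k ≤ p) [Finite V]
    (hV : ∀ x : V, p • x = 0) (hcard : p ^ r < Nat.card V) (A : Finset V) (I : Finset ι)
    (f : ι → V) (hspread : ∀ H : AddSubgroup V, H ≠ ⊤ → ∃ i ∈ I, ∃ i' ∈ I, f i - f i' ∉ H)
    (hA : 2 * A.card < k ^ (r + 1)) (hA₀ : A.Nonempty) :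
    ∃ i ∈ I, ∃ i' ∈ I,
      (1 / (2 * (r + 1) * k) : ℝ) * A.card ≤ shiftDefect A (f i - f i') := by
  by_contra! hcon
  set D : ℕ := ⌊(1 / (2 * (r + 1) * k) : ℝ) * A.card⌋₊ with hDdef
  obtain ⟨H, B, -, -, hB, hBD⟩ := exists_box hp hkp hV hcard A I f hspread (D := D)
    (fun i hi i' hi' => Nat.le_floor (hcon i hi i' hi').le) (r + 1) le_rfl
  have hD : (D : ℝ) ≤ (1 / (2 * (r + 1) * k) : ℝ) * A.card := Nat.floor_le (by positivity)
  have hBD' : 2 * ((r + 1) * k * D) ≤ A.card := by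
    have hk' : (0 : ℝ) < k := by exact_mod_cast hk
    have : (2 * ((r + 1) * k * D) : ℝ) ≤ A.card := by
      calc (2 * ((r + 1) * k * D) : ℝ)
          ≤ 2 * ((r + 1) * k * ((1 / (2 * (r + 1) * k) : ℝ) * A.card)) := by gcongr
        _ = A.card := by field_simp
    exact_mod_cast this
  have h1 : B.card * A.card ≤ 2 * (A.card * A.card) := by
    calc B.card * A.card = ∑ x ∈ B, A.card := by simp
      _ ≤ ∑ x ∈ B, 2 * shiftOverlap A x := Finset.sum_le_sum fun x hx => by
          have h2 := shiftOverlap_add_shiftDefect A x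
          have h3 := hBD x hx
          omega
      _ ≤ 2 * (A.card * A.card) := by
          rw [← Finset.mul_sum]
          exact Nat.mul_le_mul_left _ (sum_shiftOverlap_le A B)
  rw [hB] at h1
  have := hA₀.card_pos
  nlinarith

/-- Growth of large sets. -/
lemma exists_shiftDefect_of_spread {p k : ℕ} (hk : 0 < k) (hkp : k ≤ p) [Finite V]
    (hV : ∀ x : V, p • x = 0) (A : Finset V) (I : Finset ι) (f : ι → V) (hI : I.Nonempty)
    {L : ℕ} (hL : ∀ H : AddSubgroup V, H ≠ ⊤ → ∀ g : V,
      (I.filter fun i => f i - g ∈ H).card ≤ L)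
    (hA : 2 * A.card ≤ Nat.card V) (hA₀ : A.Nonempty) (hI' : 4 * p * L < k * I.card) :
    ∃ i ∈ I, ∃ i' ∈ I, (1 / (4 * k) : ℝ) * A.card ≤ shiftDefect A (f i - f i') := by
  have := Fintype.ofFinite V
  by_contra! hcon
  have key := sum_shiftOverlap_differences_le hV hkp A I f (L := L) (Nat.cast_nonneg _) (by
    intro ψ hψ i _
    have hker := hL (AddMonoidHom.ker ψ.toAddMonoidHom) (by
      intro htop
      apply hψ
      ext x
      have : x ∈ AddMonoidHom.ker ψ.toAddMonoidHom := htop ▸ AddSubgroup.mem_top x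
      rw [AddMonoidHom.mem_ker] at this
      simpa using congrArg Additive.toMul this) (f i)
    refine le_trans (Nat.cast_le.2 (Finset.card_le_card fun i' hi' => ?_)) (Nat.cast_le.2 hker)
    rw [Finset.mem_filter] at hi'
    refine (@Finset.mem_filter _ _ (_) _ _).2 ⟨hi'.1, ?_⟩
    rw [AddMonoidHom.mem_ker]
    apply Additive.toMul.injective
    simp [AddChar.map_sub_eq_div, hi'.2, (ψ.val_isUnit _).ne_zero])
  have hk' : (0 : ℝ) < k := by exact_mod_cast hk
  have hA' : (0 : ℝ) < A.card := by exact_mod_cast hA₀.card_pos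
  have hN : (0 : ℝ) < I.card := by exact_mod_cast hI.card_pos
  have hlow : (k * (I.card : ℝ) ^ 2) * (3 / 4 * A.card) ≤
      ∑ j ∈ Finset.range k, ∑ i ∈ I, ∑ i' ∈ I, (shiftOverlap A (j • (f i - f i')) : ℝ) := by
    have : (k * (I.card : ℝ) ^ 2) * (3 / 4 * A.card) =
        ∑ j ∈ Finset.range k, ∑ i ∈ I, ∑ i' ∈ I, (3 / 4 * A.card : ℝ) := by
      simp only [Finset.sum_const, Finset.card_range, nsmul_eq_mul]
      ring
    rw [this]
    refine Finset.sum_le_sum fun j hj => Finset.sum_le_sum fun i hi => Finset.sum_le_sum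
      fun i' hi' => ?_
    have h1 : (shiftOverlap A (j • (f i - f i')) : ℝ) + shiftDefect A (j • (f i - f i')) = A.card :=
      by exact_mod_cast shiftOverlap_add_shiftDefect A _
    have h2 : (shiftDefect A (j • (f i - f i')) : ℝ) ≤ j * shiftDefect A (f i - f i') := by
      exact_mod_cast shiftDefect_nsmul_le A _ j
    have h3 : (j * shiftDefect A (f i - f i') : ℝ) ≤ k * ((1 / (4 * k) : ℝ) * A.card) := by
      gcongr
      · exact (Finset.mem_range.1 hj).le
      · exact (hcon i hi i' hi').le
    have h4 : k * ((1 / (4 * k) : ℝ) * A.card) = 1 / 4 * A.card := by field_simp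
    linarith
  have hVc : (2 * A.card : ℝ) ≤ Fintype.card V := by
    rw [← Nat.card_eq_fintype_card]; exact_mod_cast hA
  have hVp : (0 : ℝ) < Fintype.card V := by linarith
  have hI'' : (4 * p * L : ℝ) < k * I.card := by exact_mod_cast hI'
  have h5 := (mul_le_mul_of_nonneg_left hlow hVp.le).trans key
  have h6 : (A.card : ℝ) ^ 2 * (k * (I.card : ℝ) ^ 2) ≤
      Fintype.card V * A.card * (k * (I.card : ℝ) ^ 2) / 2 := by
    have : 0 ≤ A.card * (k * (I.card : ℝ) ^ 2) := by positivity
    nlinarith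
  have h7 : Fintype.card V * A.card * (p * (I.card * L)) <
      Fintype.card V * A.card * (k * (I.card : ℝ) ^ 2) / 4 := by
    have : 0 < Fintype.card V * (A.card : ℝ) * I.card := by positivity
    nlinarith
  nlinarith

end Growth

section ShortZeroSum

variable {V : Type*} [AddCommGroup V] {ι : Type*}

/-- Some `2 * t` of the indices in `I` support at least `a` distinct sums of length `t`. -/
def HasManySums (f : ι → V) (I : Finset ι) (t : ℕ) (a : ℝ) : Prop :=
  ∃ U ⊆ I, U.card = 2 * t ∧ ∃ A : Finset V, A.Nonempty ∧ a ≤ A.card ∧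
    ∀ x ∈ A, ∃ J ⊆ U, J.card = t ∧ ∑ i ∈ J, f i = x

lemma HasManySums.mono {f : ι → V} {I : Finset ι} {t : ℕ} {a b : ℝ} (h : HasManySums f I t a)
    (hab : b ≤ a) : HasManySums f I t b := by
  obtain ⟨U, hU, hUc, A, hA, ha, hs⟩ := h
  exact ⟨U, hU, hUc, A, hA, hab.trans ha, hs⟩

lemma HasManySums.step {f : ι → V} {I : Finset ι} {t M : ℕ} {a b δ : ℝ} (hδ : 0 < δ)
    (hgrow : ∀ I' ⊆ I, M ≤ I'.card → ∀ A : Finset V, A.Nonempty → (A.card : ℝ) < b →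
      ∃ i ∈ I', ∃ i' ∈ I', δ * A.card ≤ shiftDefect A (f i - f i'))
    (h : HasManySums f I t a) (hI : M + 2 * t ≤ I.card) :
    ∃ t' ≤ t + 1, HasManySums f I t' (min b ((1 + δ) * a)) := by
  obtain ⟨U, hU, hUc, A, hA, ha, hs⟩ := h
  rcases le_or_gt b A.card with hb | hb
  · exact ⟨t, by omega, U, hU, hUc, A, hA, (min_le_left _ _).trans hb, hs⟩
  have hcard : M ≤ (I \ U).card := by
    rw [Finset.card_sdiff_of_subset hU]; omega
  obtain ⟨i, hi, i', hi', hd⟩ := hgrow _ Finset.sdiff_subset hcard A hA hb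
  rw [Finset.mem_sdiff] at hi hi'
  have hApos : (0 : ℝ) < A.card := by exact_mod_cast hA.card_pos
  have hne : i ≠ i' := by
    rintro rfl
    rw [sub_self, shiftDefect_zero] at hd
    have : 0 < δ * A.card := by positivity
    simp only [Nat.cast_zero] at hd
    linarith
  refine ⟨t + 1, le_rfl, insert i (insert i' U), ?_, ?_,
    (A ∪ A.image fun a => a + (f i - f i')).image fun a => a + f i', ?_, ?_, ?_⟩
  · exact Finset.insert_subset hi.1 (Finset.insert_subset hi'.1 hU)
  · rw [Finset.card_insert_of_notMem, Finset.card_insert_of_notMem hi'.2, hUc]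
    · ring
    · simp [hne, hi.2]
  · exact (hA.mono Finset.subset_union_left).image _
  · rw [Finset.card_image_of_injective _ (add_left_injective _), card_union_image_add]
    push_cast
    refine (min_le_right _ _).trans ?_
    nlinarith
  · intro x hx
    obtain ⟨y, hy, rfl⟩ := Finset.mem_image.1 hx
    rcases Finset.mem_union.1 hy with hy | hy
    · obtain ⟨J, hJ, hJc, rfl⟩ := hs y hy
      have hiJ : i' ∉ J := fun h => hi'.2 (hJ h)
      refine ⟨insert i' J, (Finset.insert_subset_insert _ hJ).trans (Finset.subset_insert _ _),
        by rw [Finset.card_insert_of_notMem hiJ, hJc], ?_⟩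
      rw [Finset.sum_insert hiJ, add_comm]
    · obtain ⟨z, hz, rfl⟩ := Finset.mem_image.1 hy
      obtain ⟨J, hJ, hJc, rfl⟩ := hs z hz
      have hiJ : i ∉ J := fun h => hi.2 (hJ h)
      refine ⟨insert i J, Finset.insert_subset_insert _ (hJ.trans (Finset.subset_insert _ _)),
        by rw [Finset.card_insert_of_notMem hiJ, hJc], ?_⟩
      rw [Finset.sum_insert hiJ]
      abel

lemma HasManySums.iterate {f : ι → V} {I : Finset ι} {t M : ℕ} {a b δ : ℝ} (hδ : 0 < δ)
    (ha : 0 ≤ a) (hb₀ : 0 ≤ b)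
    (hgrow : ∀ I' ⊆ I, M ≤ I'.card → ∀ A : Finset V, A.Nonempty → (A.card : ℝ) < b →
      ∃ i ∈ I', ∃ i' ∈ I', δ * A.card ≤ shiftDefect A (f i - f i'))
    (h : HasManySums f I t a) (m : ℕ) (hI : M + 2 * (t + m) ≤ I.card) :
    ∃ t' ≤ t + m, HasManySums f I t' (min b ((1 + m * δ) * a)) := by
  induction m with
  | zero => exact ⟨t, le_rfl, h.mono (by simp)⟩
  | succ m ih =>
    obtain ⟨t', ht', h'⟩ := ih (by omega)
    obtain ⟨s, hs, h''⟩ := h'.step hδ hgrow (by omega)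
    refine ⟨s, by omega, h''.mono ?_⟩
    push_cast
    rw [le_min_iff]
    refine ⟨min_le_left _ _, ?_⟩
    rcases le_total b ((1 + m * δ) * a) with hb | hb
    · rw [min_eq_left hb]
      exact (min_le_left _ _).trans (by nlinarith)
    · rw [min_eq_right hb]
      refine (min_le_right _ _).trans ?_
      have : 0 ≤ m * δ ^ 2 * a := by positivity
      nlinarith

lemma exists_hasManySums_pow_two {p r M : ℕ} (hp : p.Prime) [Finite V] (hV : ∀ x : V, p • x = 0)
    (hcard : p ^ r < Nat.card V) (f : ι → V) (I : Finset ι)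
    (hspread : ∀ I' ⊆ I, M ≤ I'.card → ∀ H : AddSubgroup V, H ≠ ⊤ →
      ∃ i ∈ I', ∃ i' ∈ I', f i - f i' ∉ H) (j : ℕ) (hj : 2 ^ j ≤ p)
    (hI : M + 2 * (4 * (r + 1) * 2 ^ (r + 1) * 2 ^ j) ≤ I.card) :
    ∃ t ≤ 4 * (r + 1) * 2 ^ (r + 1) * 2 ^ j, HasManySums f I t ((2 ^ j) ^ (r + 1) / 2) := by
  induction j with
  | zero =>
    refine ⟨0, by simp, ∅, by simp, by simp, {0}, by simp, by norm_num, ?_⟩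
    intro x hx
    exact ⟨∅, by simp, by simp, by simpa using (Finset.mem_singleton.1 hx).symm⟩
  | succ j ih =>
    rw [pow_succ] at hj
    have e : 4 * (r + 1) * 2 ^ (r + 1) * 2 ^ (j + 1) =
      4 * (r + 1) * 2 ^ (r + 1) * 2 ^ j + 4 * (r + 1) * 2 ^ (r + 1) * 2 ^ j := by ring
    rw [e] at hI ⊢
    obtain ⟨t, ht, h⟩ := ih (by omega) (by omega)
    have hgrow : ∀ I' ⊆ I, M ≤ I'.card → ∀ A : Finset V, A.Nonempty →
        (A.card : ℝ) < (2 ^ (j + 1)) ^ (r + 1) / 2 → ∃ i ∈ I', ∃ i' ∈ I',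
        (1 / (2 * (r + 1) * (2 ^ (j + 1) : ℕ)) : ℝ) * A.card ≤ shiftDefect A (f i - f i') := by
      intro I' hI' hM A hA hAc
      refine exists_shiftDefect_of_small hp (by positivity) (by rw [pow_succ]; exact hj) hV hcard
        A I' f (hspread I' hI' hM) ?_ hA
      have : (2 * A.card : ℝ) < (2 ^ (j + 1)) ^ (r + 1) := by linarith
      exact_mod_cast this
    obtain ⟨t', ht', h'⟩ := h.iterate (by positivity) (by positivity) (by positivity) hgrow
      (4 * (r + 1) * 2 ^ (r + 1) * 2 ^ j) (by omega)
    refine ⟨t', by omega, h'.mono (le_min le_rfl ?_)⟩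
    push_cast
    have : (4 * (r + 1) * 2 ^ (r + 1) * 2 ^ j * (1 / (2 * (r + 1) * 2 ^ (j + 1))) : ℝ) =
        2 ^ (r + 1) := by
      field_simp
      ring
    rw [this]
    have h2 : ((2 : ℝ) ^ (j + 1)) ^ (r + 1) = 2 ^ (r + 1) * (2 ^ j) ^ (r + 1) := by
      rw [pow_succ (2 : ℝ) j, mul_comm, mul_pow]
    rw [h2]
    have : (0 : ℝ) ≤ (2 ^ j) ^ (r + 1) := by positivity
    linarith

/-- A family that is spread out with respect to cosets of proper subgroups has short sums covering
more than half of the group. -/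
lemma exists_hasManySums_half {p r L E Q : ℕ} (hp : p.Prime) [Finite V] (hV : ∀ x : V, p • x = 0)
    (hcard : p ^ r < Nat.card V) (hcard' : Nat.card V ≤ p ^ (r + 1)) (f : ι → V) (I : Finset ι)
    (hL₀ : 0 < L)
    (hL : ∀ H : AddSubgroup V, H ≠ ⊤ → ∀ g : V, (I.filter fun i => f i - g ∈ H).card ≤ L)
    (hE : E = 4 * (4 * (r + 1) * 2 ^ (r + 1))) (hQ : Q = (2 * E) ^ (r + 1)) (hpQ : 32 * Q ≤ p)
    (hI : 512 * Q * L + p ≤ I.card) :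
    ∃ t, 2 * t ≤ p ∧ HasManySums f I t ((Nat.card V + 1) / 2) := by
  have hEpos : 0 < E := by rw [hE]; positivity
  have hQpos : 0 < Q := by rw [hQ]; positivity
  have hEQ : 2 * E ≤ Q := by rw [hQ]; exact Nat.le_self_pow (by omega) _
  set M := 512 * Q * L with hM
  have hLM : L < M := by rw [hM]; nlinarith
  have hL' : ∀ I' ⊆ I, ∀ H : AddSubgroup V, H ≠ ⊤ → ∀ g : V,
      (I'.filter fun i => f i - g ∈ H).card ≤ L := fun I' hI' H hH g =>
    (Finset.card_le_card (Finset.filter_subset_filter _ hI')).trans (hL H hH g)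
  have hspread : ∀ I' ⊆ I, M ≤ I'.card → ∀ H : AddSubgroup V, H ≠ ⊤ →
      ∃ i ∈ I', ∃ i' ∈ I', f i - f i' ∉ H := by
    intro I' hI' hMI H hH
    by_contra! hcon
    obtain ⟨i', hi'⟩ := Finset.card_pos.1 (show 0 < I'.card by omega)
    have := hL' I' hI' H hH (f i')
    rw [Finset.filter_true_of_mem fun i hi => hcon i hi i' hi'] at this
    omega
  have hpE : 1 ≤ p / E := (Nat.le_div_iff_mul_le hEpos).2 (by omega)
  set j := Nat.log 2 (p / E) with hj
  have hj1 : 2 ^ j ≤ p / E := Nat.pow_log_le_self 2 (by omega)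
  have hj2 : p / E < 2 ^ (j + 1) := Nat.lt_pow_succ_log_self (by norm_num) _
  have hj3 : E * 2 ^ j ≤ p := by
    calc E * 2 ^ j ≤ E * (p / E) := by gcongr
      _ ≤ p := Nat.mul_div_le p E
  have hj4 : p < 2 * E * 2 ^ j := by
    have := (Nat.div_lt_iff_lt_mul hEpos).1 hj2
    rw [pow_succ] at this
    linarith
  have hC : 4 * (4 * (r + 1) * 2 ^ (r + 1) * 2 ^ j) ≤ p := by
    rw [hE] at hj3; linarith
  obtain ⟨t, ht, h⟩ := exists_hasManySums_pow_two hp hV hcard f I hspread j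
    (by nlinarith) (by omega)
  set k := p / (32 * Q) with hk
  have hk1 : 1 ≤ k := (Nat.le_div_iff_mul_le (by omega)).2 (by omega)
  have hk2 : 32 * Q * k ≤ p := Nat.mul_div_le _ _
  have hk3 : p < 32 * Q * (k + 1) := Nat.lt_mul_div_succ p (by omega)
  have hkp : k ≤ p := Nat.div_le_self _ _
  have hgrow : ∀ I' ⊆ I, M ≤ I'.card → ∀ A : Finset V, A.Nonempty →
      (A.card : ℝ) < (Nat.card V + 1) / 2 → ∃ i ∈ I', ∃ i' ∈ I',
      (1 / (4 * k) : ℝ) * A.card ≤ shiftDefect A (f i - f i') := by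
    intro I' hI' hMI A hA hAc
    refine exists_shiftDefect_of_spread (by omega) hkp hV A I' f
      (Finset.card_pos.1 (by omega)) (hL' I' hI') ?_ hA ?_
    · have : (2 * A.card : ℝ) < Nat.card V + 1 := by linarith
      have : 2 * A.card < Nat.card V + 1 := by exact_mod_cast this
      omega
    · calc 4 * p * L < 4 * (64 * Q * k) * L := by
            have : p < 64 * Q * k := by nlinarith
            gcongr
        _ ≤ k * M := by rw [hM]; nlinarith [Nat.zero_le (k * (Q * L))]
        _ ≤ k * I'.card := by gcongr
  have hk' : (0 : ℝ) < k := by exact_mod_cast hk1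
  obtain ⟨t', ht', h'⟩ := h.iterate (by positivity) (by positivity) (by positivity) hgrow (p / 4)
    (by omega)
  refine ⟨t', by omega, h'.mono (le_min le_rfl ?_)⟩
  have hm : (Q : ℝ) ≤ (p / 4 : ℕ) * (1 / (4 * k)) := by
    rw [mul_one_div, le_div_iff₀ (by positivity)]
    have : Q * (4 * k) ≤ p / 4 := by
      rw [Nat.le_div_iff_mul_le (by norm_num)]
      nlinarith
    exact_mod_cast this
  have hV' : (Nat.card V : ℝ) ≤ Q * (2 ^ j) ^ (r + 1) := by
    have : Nat.card V ≤ Q * (2 ^ j) ^ (r + 1) := by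
      rw [hQ, ← mul_pow]
      exact hcard'.trans (Nat.pow_le_pow_left hj4.le _)
    exact_mod_cast this
  have h1 : (1 : ℝ) ≤ (2 ^ j) ^ (r + 1) := one_le_pow₀ (one_le_pow₀ (by norm_num))
  nlinarith

lemma card_mul_prime_le_of_ne_top {p : ℕ} (hp : p.Prime) [Finite V] (hV : ∀ x : V, p • x = 0)
    {H : AddSubgroup V} (hH : H ≠ ⊤) : Nat.card H * p ≤ Nat.card V := by
  obtain ⟨v, hv⟩ : ∃ v, v ∉ H := by
    by_contra! h
    exact hH (by ext; simp [h])
  rw [AddSubgroup.card_eq_card_quotient_mul_card_addSubgroup H, mul_comm]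
  refine Nat.mul_le_mul_right _ ?_
  have hord : addOrderOf (QuotientAddGroup.mk v : V ⧸ H) = p := by
    have := Fact.mk hp
    refine addOrderOf_eq_prime ?_ ?_
    · rw [← QuotientAddGroup.mk_nsmul, hV, QuotientAddGroup.mk_zero]
    · rwa [Ne, QuotientAddGroup.eq_zero_iff]
  rw [← hord]
  exact Nat.le_of_dvd Nat.card_pos (addOrderOf_dvd_natCard _)

/-- **Alon–Dubiner theorem** for elementary abelian groups: for fixed rank, linearly many (in `p`)
elements contain `p` elements with sum zero. -/
theorem exists_zero_sum_of_length_prime (r : ℕ) : ∃ c : ℕ, 0 < c ∧ ∀ p : ℕ, p.Prime →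
    ∀ (V : Type) [AddCommGroup V] [Finite V], (∀ x : V, p • x = 0) → Nat.card V ≤ p ^ r →
    ∀ (ι : Type) (I : Finset ι) (f : ι → V), c * p ≤ I.card →
    ∃ J ⊆ I, J.card = p ∧ ∑ i ∈ J, f i = 0 := by
  induction r with
  | zero =>
    refine ⟨1, one_pos, fun p hp V _ _ hV hcard ι I f hI => ?_⟩
    obtain ⟨J, hJ, hJc⟩ := Finset.exists_subset_card_eq (show p ≤ I.card by omega)
    have := Finite.card_le_one_iff_subsingleton.1 (by simpa using hcard)
    exact ⟨J, hJ, hJc, Subsingleton.elim _ _⟩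
  | succ r ih =>
    obtain ⟨c, hc, ih⟩ := ih
    obtain ⟨E, hE⟩ : ∃ E, E = 4 * (4 * (r + 1) * 2 ^ (r + 1)) := ⟨_, rfl⟩
    obtain ⟨Q, hQ⟩ : ∃ Q, Q = (2 * E) ^ (r + 1) := ⟨_, rfl⟩
    have hQpos : 0 < Q := by rw [hQ, hE]; positivity
    refine ⟨max ((32 * Q) ^ (r + 1)) (512 * Q * c + 3), by positivity,
      fun p hp V _ _ hV hcard ι I f hI => ?_⟩
    rcases lt_or_ge p (32 * Q) with hpQ | hpQ
    · -- some value is taken `p` times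
      have := Fintype.ofFinite V
      have hI' : Fintype.card V * p ≤ I.card := by
        rw [← Nat.card_eq_fintype_card]
        calc Nat.card V * p ≤ (32 * Q) ^ (r + 1) * p := by
              gcongr
              exact hcard.trans (Nat.pow_le_pow_left hpQ.le _)
          _ ≤ _ := (Nat.mul_le_mul_right _ (le_max_left _ _)).trans hI
      obtain ⟨v, -, hv⟩ := Finset.exists_le_card_fiber_of_mul_le_card_of_maps_to
        (s := I) (t := Finset.univ) (f := f) (n := p) (fun _ _ => Finset.mem_univ _)
        ⟨0, Finset.mem_univ _⟩ (by rwa [Finset.card_univ])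
      obtain ⟨J, hJ, hJc⟩ := Finset.exists_subset_card_eq hv
      refine ⟨J, hJ.trans (Finset.filter_subset _ _), hJc, ?_⟩
      rw [Finset.sum_congr rfl fun i hi => (Finset.mem_filter.1 (hJ hi)).2, Finset.sum_const, hJc,
        hV]
    have hI' : (512 * Q * c + 3) * p ≤ I.card :=
      (Nat.mul_le_mul_right _ (le_max_right _ _)).trans hI
    rcases le_or_gt (Nat.card V) (p ^ r) with hsmall | hcard'
    · exact ih p hp V hV hsmall ι I f ((Nat.mul_le_mul_right p (by nlinarith)).trans hI')
    by_cases hL : ∀ H : AddSubgroup V, H ≠ ⊤ → ∀ g : V,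
      (I.filter fun i => f i - g ∈ H).card ≤ c * p
    · obtain ⟨t, ht, U, hU, hUc, A, -, hA, hs⟩ := exists_hasManySums_half hp hV hcard' hcard f I
        (Nat.mul_pos hc hp.pos) hL hE hQ hpQ (by nlinarith)
      have hIU : (I \ U).card = I.card - 2 * t := by rw [Finset.card_sdiff_of_subset hU, hUc]
      obtain ⟨s, hs', U', hU', hUc', A', -, hA', hs''⟩ := exists_hasManySums_half hp hV hcard'
        hcard f (I \ U) (Nat.mul_pos hc hp.pos)
        (fun H hH g => (Finset.card_le_card
          (Finset.filter_subset_filter _ Finset.sdiff_subset)).trans (hL H hH g)) hE hQ hpQ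
        (by rw [hIU]; apply Nat.le_sub_of_add_le; nlinarith)
      obtain ⟨P, hP, hPc⟩ := Finset.exists_subset_card_eq
        (show p - t - s ≤ ((I \ U) \ U').card by
          rw [Finset.card_sdiff_of_subset hU', hIU, hUc']
          have : 3 * p ≤ I.card := (Nat.mul_le_mul_right p (by omega)).trans hI'
          omega)
      have hinter : ∃ x ∈ A, ∃ y ∈ A', x + y + ∑ i ∈ P, f i = 0 := by
        have hcardsum : Nat.card V < A.card + (A'.image fun y => -(y + ∑ i ∈ P, f i)).card := by
          have hinj : Function.Injective fun y : V => -(y + ∑ i ∈ P, f i) :=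
            fun a b h => by simpa using h
          rw [Finset.card_image_of_injective _ hinj]
          have : (Nat.card V : ℝ) < A.card + A'.card := by linarith
          exact_mod_cast this
        have := Fintype.ofFinite V
        rw [Nat.card_eq_fintype_card, ← Finset.card_univ] at hcardsum
        obtain ⟨x, hx⟩ := Finset.inter_nonempty_of_card_lt_card_add_card
          (Finset.subset_univ _) (Finset.subset_univ _) hcardsum
        rw [Finset.mem_inter, Finset.mem_image] at hx
        obtain ⟨hxA, y, hy, hxy⟩ := hx
        exact ⟨x, hxA, y, hy, by rw [← hxy]; abel⟩
      obtain ⟨x, hx, y, hy, hxy⟩ := hinter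
      obtain ⟨J, hJ, hJc, rfl⟩ := hs x hx
      obtain ⟨J', hJ', hJc', rfl⟩ := hs'' y hy
      have d1 : Disjoint J J' := by
        rw [Finset.disjoint_left]
        exact fun i hi hi' => (Finset.mem_sdiff.1 (hU' (hJ' hi'))).2 (hJ hi)
      have d2 : Disjoint (J ∪ J') P := by
        rw [Finset.disjoint_left]
        intro i hi hi'
        have := hP hi'
        rw [Finset.mem_sdiff, Finset.mem_sdiff] at this
        rcases Finset.mem_union.1 hi with h | h
        · exact this.1.2 (hJ h)
        · exact this.2 (hJ' h)
      refine ⟨J ∪ J' ∪ P, ?_, ?_, ?_⟩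
      · refine Finset.union_subset (Finset.union_subset (hJ.trans hU) ?_) ?_
        · exact hJ'.trans (hU'.trans Finset.sdiff_subset)
        · exact hP.trans (Finset.sdiff_subset.trans Finset.sdiff_subset)
      · rw [Finset.card_union_of_disjoint d2, Finset.card_union_of_disjoint d1, hJc, hJc', hPc]
        omega
      · rw [Finset.sum_union d2, Finset.sum_union d1, hxy]
    · push Not at hL
      obtain ⟨H, hH, g, hlarge⟩ := hL
      have hHc : Nat.card H ≤ p ^ r := by
        have h1 := card_mul_prime_le_of_ne_top hp hV hH
        rw [pow_succ] at hcard
        exact Nat.le_of_mul_le_mul_right (h1.trans hcard) hp.pos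
      obtain ⟨J, hJ, hJc, hJs⟩ := ih p hp H (fun x => Subtype.ext (by simpa using hV x)) hHc ι
        (I.filter fun i => f i - g ∈ H) (fun i => if h : f i - g ∈ H then ⟨f i - g, h⟩ else 0)
        hlarge.le
      refine ⟨J, hJ.trans (Finset.filter_subset _ _), hJc, ?_⟩
      have hJs' := congrArg Subtype.val hJs
      rw [AddSubgroup.val_finsetSum, Finset.sum_congr rfl (g := fun i => f i - g) (fun i hi => by
        rw [dif_pos (Finset.mem_filter.1 (hJ hi)).2]), Finset.sum_sub_distrib, Finset.sum_const,
        hJc, hV, sub_zero] at hJs'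
      simpa using hJs'

end ShortZeroSum

section Olson

lemma exists_nonempty_zero_sum_zmod {p r : ℕ} [Fact p.Prime] {V : Type*} [AddCommGroup V]
    [Module (ZMod p) V] [Finite V] (hcard : Nat.card V ≤ p ^ r) {ι : Type*} (I : Finset ι)
    (f : ι → V) (hI : r * (p - 1) < I.card) : ∃ J ⊆ I, J.Nonempty ∧ ∑ i ∈ J, f i = 0 := by
  have hp : p.Prime := Fact.out
  let s := Module.finrank (ZMod p) V
  let b : Module.Basis (Fin s) (ZMod p) V := Module.finBasis (ZMod p) V
  have hsr : s ≤ r := by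
    rw [Module.natCard_eq_pow_finrank (K := ZMod p), Nat.card_zmod] at hcard
    exact (Nat.pow_le_pow_iff_right hp.one_lt).1 hcard
  let F : Fin s → MvPolynomial I (ZMod p) := fun j =>
    ∑ i : I, b.repr (f i) j • MvPolynomial.X i ^ (p - 1)
  have hdeg : ∑ j, (F j).totalDegree < Fintype.card I := by
    rw [Fintype.card_coe]
    refine lt_of_le_of_lt ?_ hI
    calc ∑ j, (F j).totalDegree ≤ ∑ _j : Fin s, (p - 1) := by
          refine Finset.sum_le_sum fun j _ => ?_
          refine MvPolynomial.totalDegree_finsetSum_le fun i _ => ?_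
          refine (MvPolynomial.totalDegree_smul_le _ _).trans ?_
          rw [MvPolynomial.totalDegree_X_pow]
      _ = s * (p - 1) := by simp
      _ ≤ r * (p - 1) := Nat.mul_le_mul_right _ hsr
  have hF : ∀ (x : I → ZMod p) (j : Fin s), MvPolynomial.eval x (F j) =
      b.repr (∑ i : I with x i ≠ 0, f i) j := by
    intro x j
    simp only [F, map_sum, MvPolynomial.smul_eval, map_pow, MvPolynomial.eval_X,
      ZMod.pow_card_sub_one, Finset.sum_filter, Finsupp.coe_finsetSum, Finset.sum_apply]
    refine Finset.sum_congr rfl fun i _ => ?_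
    by_cases h : x i = 0 <;> simp [h]
  have hdvd : p ∣ Nat.card {x : I → ZMod p // ∀ j, MvPolynomial.eval x (F j) = 0} :=
    (@Nat.card_eq_fintype_card _ (_)) ▸ char_dvd_card_solutions_of_fintype_sum_lt p hdeg
  let z : {x : I → ZMod p // ∀ j, MvPolynomial.eval x (F j) = 0} :=
    ⟨0, fun j => by rw [hF]; simp⟩
  have : Nonempty {x : I → ZMod p // ∀ j, MvPolynomial.eval x (F j) = 0} := ⟨z⟩
  have := Finite.one_lt_card_iff_nontrivial.1
    (hp.one_lt.trans_le (Nat.le_of_dvd Nat.card_pos hdvd))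
  obtain ⟨x, hx⟩ := exists_ne z
  refine ⟨({i | x.1 i ≠ 0} : Finset I).map ⟨(↑), Subtype.val_injective⟩, ?_, ?_, ?_⟩
  · simp +contextual [Finset.subset_iff]
  · rw [← Subtype.coe_ne_coe, Function.ne_iff] at hx
    obtain ⟨i, hi⟩ := hx
    exact Finset.Nonempty.map ⟨i, Finset.mem_filter.2 ⟨Finset.mem_univ _, hi⟩⟩
  · rw [Finset.sum_map]
    refine b.repr.injective (Finsupp.ext fun j => ?_)
    have := x.2 j
    rw [hF] at this
    simpa using this

/-- **Olson's theorem** for elementary abelian groups, in the form `D(C_p^r) ≤ r (p - 1) + 1`. -/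
theorem exists_nonempty_zero_sum_prime {p r : ℕ} (hp : p.Prime) {V : Type*} [AddCommGroup V]
    [Finite V] (hV : ∀ x : V, p • x = 0) (hcard : Nat.card V ≤ p ^ r) {ι : Type*} (I : Finset ι)
    (f : ι → V) (hI : r * (p - 1) < I.card) : ∃ J ⊆ I, J.Nonempty ∧ ∑ i ∈ J, f i = 0 :=
  have := Fact.mk hp
  let _ : Module (ZMod p) V := AddCommGroup.zmodModule hV
  exists_nonempty_zero_sum_zmod hcard I f hI

end Olson

section Torsion

/-- The `p`-torsion subgroup of `C_n^r`. -/
abbrev torsionPi (r n p : ℕ) : AddSubgroup (Fin r → ZMod n) :=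
  (nsmulAddMonoidHom (α := Fin r → ZMod n) p).ker

lemma nsmul_torsionPi {r n p : ℕ} (x : torsionPi r n p) : p • x = 0 :=
  Subtype.ext x.2

lemma card_torsionPi_le {r n p : ℕ} [NeZero n] (hp : 0 < p) :
    Nat.card (torsionPi r n p) ≤ p ^ r := by
  let T := {y : ZMod n // p • y = 0}
  have hT : Nat.card T ≤ p := by
    rw [Nat.card_eq_fintype_card, Fintype.card_subtype]
    exact IsAddCyclic.card_nsmul_eq_zero_le hp
  let φ : torsionPi r n p → Fin r → T := fun x i => ⟨x.1 i, congrFun x.2 i⟩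
  have hφ : Function.Injective φ := fun x y h =>
    Subtype.ext (funext fun i => congrArg Subtype.val (congrFun h i))
  calc Nat.card (torsionPi r n p) ≤ Nat.card (Fin r → T) := Nat.card_le_card_of_injective φ hφ
    _ = Nat.card T ^ r := by simp
    _ ≤ p ^ r := Nat.pow_le_pow_left hT r

end Torsion

section Reduction

variable {G : Type*} [AddCommGroup G]

lemma Multiset.exists_map_univ_eq {α : Type*} (T : Multiset α) :
    ∃ f : Fin (Multiset.card T) → α, Finset.univ.val.map f = T := by
  induction T using Quotient.inductionOn with
  | h l =>
    refine ⟨l.get, ?_⟩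
    change Finset.univ.val.map l.get = (l : Multiset α)
    erw [Fin.univ_val_map, List.ofFn_get]

lemma crossNumber_add (S T : Multiset G) :
    crossNumber (S + T) = crossNumber S + crossNumber T := by
  simp [crossNumber]

lemma crossNumber_cons (g : G) (S : Multiset G) :
    crossNumber (g ::ₘ S) = 1 / addOrderOf g + crossNumber S := by
  simp [crossNumber]

lemma crossNumber_of_forall_addOrderOf_eq {S : Multiset G} {d : ℕ}
    (h : ∀ g ∈ S, addOrderOf g = d) : crossNumber S = Multiset.card S / d := by
  rw [crossNumber, Multiset.map_congr rfl fun g hg => by rw [h g hg]]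
  simp [div_eq_mul_inv]

/-- Replacing a subsequence by its sum preserves zero-sumfreeness. -/
lemma IsZeroSumFree.cons_sum {S T : Multiset G} (hS : IsZeroSumFree (T + S)) (hT0 : T ≠ 0) :
    IsZeroSumFree (T.sum ::ₘ S) := by
  intro U hU hU0 hsum
  by_cases hmem : T.sum ∈ U
  · obtain ⟨U', rfl⟩ := Multiset.exists_cons_of_mem hmem
    have hU' : U' ≤ S := (Multiset.cons_le_cons_iff _).1 hU
    exact hS (T + U') (by gcongr) (by simp [hT0]) (by simpa using hsum)
  · exact hS U (((Multiset.le_cons_of_notMem hmem).1 hU).trans (Multiset.le_add_left _ _)) hU0 hsum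

end Reduction

section UpperBound

lemma IsZeroSumFree.card_filter_addOrderOf_prime_le {r n p : ℕ} [NeZero n] (hp : p.Prime)
    {S : Multiset (Fin r → ZMod n)} (hS : IsZeroSumFree S) :
    Multiset.card (S.filter fun g => addOrderOf g = p) ≤ r * (p - 1) := by
  by_contra! hcon
  obtain ⟨f, hf⟩ := Multiset.exists_map_univ_eq (S.filter fun g => addOrderOf g = p)
  have hord : ∀ i, addOrderOf (f i) = p := fun i => by
    have h := Multiset.mem_map_of_mem f (Finset.mem_univ_val i)
    rw [hf] at h
    exact (Multiset.mem_filter.1 h).2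
  obtain ⟨J, -, hJ, hJs⟩ := exists_nonempty_zero_sum_prime hp (nsmul_torsionPi (r := r) (n := n))
    (card_torsionPi_le hp.pos) Finset.univ
    (fun i => (⟨f i, by
      rw [AddMonoidHom.mem_ker]
      exact hord i ▸ addOrderOf_nsmul_eq_zero (f i)⟩ : torsionPi r n p))
    (by simpa using hcon)
  refine hS (J.val.map f) ?_ ?_ ?_
  · calc J.val.map f ≤ Finset.univ.val.map f :=
          Multiset.map_le_map (Finset.val_le_iff.2 (Finset.subset_univ J))
      _ ≤ S := by rw [hf]; exact Multiset.filter_le _ _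
  · simpa using hJ.ne_empty
  · have := congrArg Subtype.val hJs
    rw [AddSubgroup.val_finsetSum] at this
    exact this

lemma IsZeroSumFree.exists_card_lt {r n c d : ℕ} [NeZero n]
    (hc : ∀ p : ℕ, p.Prime →
      ∀ (V : Type) [AddCommGroup V] [Finite V], (∀ x : V, p • x = 0) → Nat.card V ≤ p ^ r →
      ∀ (ι : Type) (I : Finset ι) (f : ι → V), c * p ≤ I.card →
      ∃ J ⊆ I, J.card = p ∧ ∑ i ∈ J, f i = 0)
    {S : Multiset (Fin r → ZMod n)} (hS : IsZeroSumFree S) (hd : 1 < d)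
    (hcard : c * d.minFac ≤ Multiset.card (S.filter fun g => addOrderOf g = d)) :
    ∃ S' : Multiset (Fin r → ZMod n), IsZeroSumFree S' ∧ Multiset.card S' < Multiset.card S ∧
      crossNumber S ≤ crossNumber S' := by
  set p := d.minFac with hpd
  have hp : p.Prime := Nat.minFac_prime hd.ne'
  obtain ⟨m, hm⟩ := d.minFac_dvd
  rw [← hpd] at hm
  obtain ⟨f, hf⟩ := Multiset.exists_map_univ_eq (S.filter fun g => addOrderOf g = d)
  have hord : ∀ i, addOrderOf (f i) = d := fun i => by
    have h := Multiset.mem_map_of_mem f (Finset.mem_univ_val i)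
    rw [hf] at h
    exact (Multiset.mem_filter.1 h).2
  obtain ⟨J, -, hJ, hJs⟩ := hc p hp (torsionPi r n p) nsmul_torsionPi (card_torsionPi_le hp.pos) _
    Finset.univ (fun i => (⟨m • f i, by
      rw [AddMonoidHom.mem_ker, nsmulAddMonoidHom_apply, smul_smul, ← hm]
      exact hord i ▸ addOrderOf_nsmul_eq_zero (f i)⟩ : torsionPi r n p))
    (by simpa using hcard)
  set T := J.val.map f with hT
  have hTS : T ≤ S := by
    calc J.val.map f ≤ Finset.univ.val.map f :=
          Multiset.map_le_map (Finset.val_le_iff.2 (Finset.subset_univ J))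
      _ ≤ S := by rw [hf]; exact Multiset.filter_le _ _
  have hTc : Multiset.card T = p := by rw [hT, Multiset.card_map, Finset.card_val, hJ]
  have hT0 : T ≠ 0 := by
    rw [← Multiset.card_pos, hTc]
    exact hp.pos
  have hTsum : m • T.sum = 0 := by
    have := congrArg Subtype.val hJs
    rw [AddSubgroup.val_finsetSum] at this
    rw [hT, Finset.sum_map_val, Finset.smul_sum]
    exact this
  have hTord : ∀ g ∈ T, addOrderOf g = d := by
    intro g hg
    obtain ⟨i, -, rfl⟩ := Multiset.mem_map.1 hg
    exact hord i
  have hm0 : 0 < m := Nat.pos_of_ne_zero (by rintro rfl; omega)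
  have hle : addOrderOf T.sum ≤ m := addOrderOf_le_of_nsmul_eq_zero hm0 hTsum
  have hpos : 0 < addOrderOf T.sum := addOrderOf_pos _
  obtain ⟨R, hR⟩ := Multiset.le_iff_exists_add.1 hTS
  rw [hR] at hS
  rw [hR]
  refine ⟨T.sum ::ₘ R, hS.cons_sum hT0, ?_, ?_⟩
  · rw [Multiset.card_cons, Multiset.card_add, hTc]
    have := hp.two_le
    omega
  · rw [crossNumber_add, crossNumber_cons, crossNumber_of_forall_addOrderOf_eq hTord, hTc, hm]
    have : (0 : ℝ) < p := by exact_mod_cast hp.pos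
    have : (0 : ℝ) < m := by exact_mod_cast hm0
    have h1 : (p : ℝ) / (p * m : ℕ) = 1 / m := by
      push_cast
      field_simp
    rw [h1]
    gcongr

/-- The sum of `P⁻(d) / d` over the composite divisors `d` of `n`, where `P⁻(d)` is the smallest
prime factor of `d`. -/
noncomputable def compositeSum (n : ℕ) : ℝ :=
  ∑ d ∈ n.divisors, if 1 < d ∧ ¬ d.Prime then (d.minFac : ℝ) / d else 0

lemma crossNumber_eq_sum_divisors {r n : ℕ} [NeZero n] (S : Multiset (Fin r → ZMod n)) :
    crossNumber S =
      ∑ d ∈ n.divisors, (Multiset.card (S.filter fun g => addOrderOf g = d) : ℝ) / d := by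
  have h : crossNumber S = ∑ d ∈ n.divisors, crossNumber (S.filter fun g => addOrderOf g = d) := by
    induction S using Multiset.induction with
    | empty => simp [crossNumber]
    | cons g S ih =>
      have hg : addOrderOf g ∈ n.divisors := by
        rw [Nat.mem_divisors]
        refine ⟨addOrderOf_dvd_of_nsmul_eq_zero ?_, NeZero.ne n⟩
        ext i
        simp
      have : ∀ d, crossNumber ((g ::ₘ S).filter fun g => addOrderOf g = d) =
          (if addOrderOf g = d then (1 : ℝ) / addOrderOf g else 0) +
            crossNumber (S.filter fun g => addOrderOf g = d) := by
        intro d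
        by_cases h : addOrderOf g = d
        · rw [Multiset.filter_cons_of_pos (p := fun g => addOrderOf g = d) _ h, crossNumber_cons,
            if_pos h]
        · rw [Multiset.filter_cons_of_neg (p := fun g => addOrderOf g = d) _ h, if_neg h, zero_add]
      simp only [this, Finset.sum_add_distrib, crossNumber_cons, ih]
      rw [Finset.sum_ite_eq, if_pos hg]
  rw [h]
  exact Finset.sum_congr rfl fun d _ =>
    crossNumber_of_forall_addOrderOf_eq fun g hg => (Multiset.mem_filter.1 hg).2

lemma exists_crossNumber_le_of_isZeroSumFree (r : ℕ) : ∃ c : ℕ, ∀ n : ℕ, n ≠ 0 →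
    ∀ S : Multiset (Fin r → ZMod n), IsZeroSumFree S →
    crossNumber S ≤ r * n.primeFactors.card + c * compositeSum n := by
  obtain ⟨c, hc0, hc⟩ := exists_zero_sum_of_length_prime r
  refine ⟨c, fun n hn S hS => ?_⟩
  have : NeZero n := ⟨hn⟩
  induction hk : Multiset.card S using Nat.strong_induction_on generalizing S with
  | _ k ih =>
  by_cases hred : ∃ d, 1 < d ∧ c * d.minFac ≤
      Multiset.card (S.filter fun g => addOrderOf g = d)
  · obtain ⟨d, hd, hcard⟩ := hred
    obtain ⟨S', hS', hlt, hle⟩ := hS.exists_card_lt hc hd hcard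
    exact hle.trans (ih _ (hk ▸ hlt) S' hS' rfl)
  push Not at hred
  rw [crossNumber_eq_sum_divisors, Nat.primeFactors_eq_to_filter_divisors_prime, compositeSum,
    Finset.mul_sum, Finset.card_filter]
  push_cast
  rw [Finset.mul_sum, ← Finset.sum_add_distrib]
  refine Finset.sum_le_sum fun d hd => ?_
  have hd0 : 0 < d := Nat.pos_of_mem_divisors hd
  rcases (show d = 1 ∨ 1 < d by omega) with rfl | hd1
  · have : S.filter (fun g => addOrderOf g = 1) = 0 := by
      rw [Multiset.filter_eq_nil]
      intro g hg hg1
      rw [AddMonoid.addOrderOf_eq_one_iff] at hg1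
      subst hg1
      exact hS {0} (Multiset.singleton_le.2 hg) (by simp) (by simp)
    rw [this]
    simp [Nat.not_prime_one]
  have hd' : (0 : ℝ) < d := by exact_mod_cast hd0
  by_cases hp : d.Prime
  · simp only [hp, if_true, not_true, and_false, if_false, mul_one, mul_zero, add_zero]
    rw [div_le_iff₀ hd']
    have := (hS.card_filter_addOrderOf_prime_le hp).trans (Nat.mul_le_mul_left r (Nat.sub_le d 1))
    exact_mod_cast this
  · simp only [hp, if_false, hd1, not_false_eq_true, and_self, if_true, mul_zero, zero_add]
    rw [← mul_div_assoc]
    gcongr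
    exact_mod_cast (hred d hd1).le

lemma exists_crossNumber_le_of_isMinimalZeroSum (r : ℕ) : ∃ c : ℕ, ∀ n : ℕ, n ≠ 0 →
    ∀ S : Multiset (Fin r → ZMod n), IsMinimalZeroSum S →
    crossNumber S ≤ 1 + r * n.primeFactors.card + c * compositeSum n := by
  obtain ⟨c, hc⟩ := exists_crossNumber_le_of_isZeroSumFree r
  refine ⟨c, fun n hn S hS => ?_⟩
  rcases Multiset.empty_or_exists_mem S with rfl | ⟨g, hg⟩
  · have := hc n hn 0 fun T hT hT0 => absurd (Multiset.le_zero.1 hT) hT0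
    linarith
  obtain ⟨S', rfl⟩ := Multiset.exists_cons_of_mem hg
  have := hc n hn S' fun T hT => hS.2 T (hT.trans_lt (Multiset.lt_cons_self _ _))
  rw [crossNumber_cons]
  have h1 : (1 : ℝ) / addOrderOf g ≤ 1 := by
    rw [one_div]
    exact Nat.cast_inv_le_one _
  linarith

end UpperBound

section LowerBound

variable {G : Type*} [AddCommGroup G]

lemma IsZeroSumFree.replicate_add {H : Type*} [AddCommGroup H] {S : Multiset G}
    (hS : IsZeroSumFree S) (L : G →+ H) (hL : ∀ g ∈ S, L g = 0) {x : G} {k : ℕ}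
    (hk : k < addOrderOf (L x)) : IsZeroSumFree (Multiset.replicate k x + S) := by
  intro T hT hT0 hsum
  have h1 : T - S ≤ Multiset.replicate k x := tsub_le_iff_right.2 hT
  obtain ⟨j, hj, hTj⟩ := Multiset.le_replicate_iff.1 h1
  have hdec : T - S + T ∩ S = T := Multiset.sub_add_inter T S
  have hker : ∀ U : Multiset G, (∀ g ∈ U, g ∈ S) → L U.sum = 0 := by
    intro U hU
    rw [map_multiset_sum]
    refine Multiset.sum_eq_zero fun y hy => ?_
    obtain ⟨g, hg, rfl⟩ := Multiset.mem_map.1 hy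
    exact hL g (hU g hg)
  have hj0 : j • L x = 0 := by
    have := congrArg L hsum
    rw [← hdec, Multiset.sum_add, map_add, hker (T ∩ S) fun g hg =>
      Multiset.mem_of_le Multiset.inter_le_right hg, hTj, Multiset.sum_replicate] at this
    simpa using this
  have hj' : j = 0 := by
    by_contra hne
    exact absurd (addOrderOf_le_of_nsmul_eq_zero (Nat.pos_of_ne_zero hne) hj0) (by omega)
  rw [hj', Multiset.replicate_zero] at hTj
  exact hS T (tsub_eq_zero_iff_le.1 hTj) hT0 hsum

lemma IsZeroSumFree.isMinimalZeroSum_cons {S : Multiset G} (hS : IsZeroSumFree S) :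
    IsMinimalZeroSum (-S.sum ::ₘ S) := by
  refine ⟨by simp, fun T hT hT0 hsum => ?_⟩
  by_cases hmem : -S.sum ∈ T
  · obtain ⟨T', rfl⟩ := Multiset.exists_cons_of_mem hmem
    have hT' : T' < S := (Multiset.cons_lt_cons_iff).1 hT
    obtain ⟨R, rfl⟩ := Multiset.le_iff_exists_add.1 hT'.le
    refine hS R (Multiset.le_add_left _ _) (by rintro rfl; simp at hT') ?_
    simpa using hsum
  · exact hS T ((Multiset.le_cons_of_notMem hmem).1 hT.le) hT0 hsum

/-- The element of `C_n^r` of order `p` supported on the coordinate `i`. -/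
def torsionSingle (r n : ℕ) (a : Fin r × ℕ) : Fin r → ZMod n :=
  Pi.single a.1 ((n / a.2 : ℕ) : ZMod n)

lemma addOrderOf_natCast_div {n p : ℕ} (hn : n ≠ 0) (hp : p ∣ n) :
    addOrderOf ((n / p : ℕ) : ZMod n) = p := by
  rw [ZMod.addOrderOf_coe _ hn, Nat.gcd_eq_right (Nat.div_dvd_of_dvd hp), Nat.div_div_self hp hn]

lemma addOrderOf_torsionSingle {r n : ℕ} (hn : n ≠ 0) {a : Fin r × ℕ} (ha : a.2 ∣ n) :
    addOrderOf (torsionSingle r n a) = a.2 := by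
  rw [← addOrderOf_natCast_div hn ha]
  exact addOrderOf_injective (AddMonoidHom.single (fun _ : Fin r => ZMod n) a.1)
    (fun x y h => Pi.single_injective (M := fun _ : Fin r => ZMod n) a.1 h) _

/-- `p - 1` copies of `torsionSingle r n (i, p)` for each `(i, p) ∈ A`. -/
def torsionSequence (r n : ℕ) (A : Finset (Fin r × ℕ)) : Multiset (Fin r → ZMod n) :=
  ∑ a ∈ A, Multiset.replicate (a.2 - 1) (torsionSingle r n a)

lemma isZeroSumFree_torsionSequence {r n : ℕ} (hn : n ≠ 0) {A : Finset (Fin r × ℕ)}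
    (hA : ∀ a ∈ A, a.2 ∈ n.primeFactors) : IsZeroSumFree (torsionSequence r n A) := by
  induction A using Finset.induction_on with
  | empty => exact fun T hT hT0 => absurd (Multiset.le_zero.1 hT) hT0
  | insert a A ha ih =>
    rw [torsionSequence, Finset.sum_insert ha]
    have hp := Nat.prime_of_mem_primeFactors (hA a (Finset.mem_insert_self _ _))
    have hpn := Nat.dvd_of_mem_primeFactors (hA a (Finset.mem_insert_self _ _))
    have hmul := Nat.ordProj_mul_ordCompl_eq_self n a.2
    set m := n / a.2 ^ n.factorization a.2 with hm
    have hpm : ¬ a.2 ∣ m := Nat.not_dvd_ordCompl hp hn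
    have hLx : ∀ b : Fin r × ℕ, ((AddMonoidHom.mulLeft (m : ZMod n)).comp
        (Pi.evalAddMonoidHom (fun _ : Fin r => ZMod n) a.1)) (torsionSingle r n b) =
        if b.1 = a.1 then ((m * (n / b.2) : ℕ) : ZMod n) else 0 := by
      intro b
      by_cases h : b.1 = a.1
      · simp [torsionSingle, h]
      · simp [torsionSingle, h]
    refine (ih fun b hb => hA b (Finset.mem_insert_of_mem hb)).replicate_add
      ((AddMonoidHom.mulLeft (m : ZMod n)).comp
        (Pi.evalAddMonoidHom (fun _ : Fin r => ZMod n) a.1)) ?_ ?_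
    · intro g hg
      obtain ⟨b, hb, hg⟩ := Multiset.mem_sum.1 hg
      rw [Multiset.eq_of_mem_replicate hg, hLx]
      split_ifs with h
      · rw [ZMod.natCast_eq_zero_iff]
        have hq := Nat.prime_of_mem_primeFactors (hA b (Finset.mem_insert_of_mem hb))
        have hqn := Nat.dvd_of_mem_primeFactors (hA b (Finset.mem_insert_of_mem hb))
        have hne : b.2 ≠ a.2 := fun h' => ha ((Prod.ext h h' : b = a) ▸ hb)
        have hqm : b.2 ∣ m := by
          have h1 := hqn
          rw [← hmul] at h1
          exact (Nat.Coprime.pow_right _ ((Nat.coprime_primes hq hp).2 hne)).dvd_of_dvd_mul_left h1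
        obtain ⟨t, ht⟩ := hqm
        exact ⟨t, by rw [ht, mul_right_comm, Nat.mul_div_cancel' hqn]⟩
      · rfl
    · rw [hLx, if_pos rfl]
      have hord : addOrderOf ((m * (n / a.2) : ℕ) : ZMod n) = a.2 := by
        have := Fact.mk hp
        refine addOrderOf_eq_prime ?_ ?_
        · rw [nsmul_eq_mul, ← Nat.cast_mul, ZMod.natCast_eq_zero_iff, mul_left_comm,
            Nat.mul_div_cancel' hpn]
          exact dvd_mul_left _ _
        · rw [Ne, ZMod.natCast_eq_zero_iff]
          intro hdvd
          refine hpm (Nat.dvd_of_mul_dvd_mul_right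
            (Nat.div_pos (Nat.le_of_dvd (Nat.pos_of_ne_zero hn) hpn) hp.pos) ?_)
          rwa [Nat.mul_div_cancel' hpn]
      rw [hord]
      exact Nat.sub_lt hp.pos one_pos

lemma crossNumber_torsionSequence {r n : ℕ} (hn : n ≠ 0) {A : Finset (Fin r × ℕ)}
    (hA : ∀ a ∈ A, a.2 ∈ n.primeFactors) :
    crossNumber (torsionSequence r n A) = ∑ a ∈ A, (1 - 1 / (a.2 : ℝ)) := by
  induction A using Finset.induction_on with
  | empty => simp [torsionSequence, crossNumber]
  | insert a A ha ih =>
    have hp := Nat.prime_of_mem_primeFactors (hA a (Finset.mem_insert_self _ _))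
    have hpn := Nat.dvd_of_mem_primeFactors (hA a (Finset.mem_insert_self _ _))
    rw [Finset.sum_insert ha, ← ih fun b hb => hA b (Finset.mem_insert_of_mem hb), torsionSequence,
      Finset.sum_insert ha, crossNumber_add, ← torsionSequence,
      crossNumber_of_forall_addOrderOf_eq (d := a.2), Multiset.card_replicate,
      Nat.cast_sub hp.one_le]
    · have : (a.2 : ℝ) ≠ 0 := by exact_mod_cast hp.ne_zero
      field_simp
      simp
    · intro g hg
      rw [Multiset.eq_of_mem_replicate hg, addOrderOf_torsionSingle hn hpn]

lemma exists_isMinimalZeroSum_le_crossNumber (r : ℕ) {n : ℕ} (hn : n ≠ 0) :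
    ∃ S : Multiset (Fin r → ZMod n), IsMinimalZeroSum S ∧
      r * ∑ p ∈ n.primeFactors, (1 - 1 / (p : ℝ)) ≤ crossNumber S := by
  have hA : ∀ a ∈ (Finset.univ : Finset (Fin r)) ×ˢ n.primeFactors, a.2 ∈ n.primeFactors :=
    fun a ha => (Finset.mem_product.1 ha).2
  refine ⟨_, (isZeroSumFree_torsionSequence hn hA).isMinimalZeroSum_cons, ?_⟩
  rw [crossNumber_cons, crossNumber_torsionSequence hn hA, Finset.sum_product]
  dsimp only
  rw [Finset.sum_const, Finset.card_univ, Fintype.card_fin, nsmul_eq_mul]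
  have : (0 : ℝ) ≤ 1 / addOrderOf (-(torsionSequence r n
    ((Finset.univ : Finset (Fin r)) ×ˢ n.primeFactors)).sum) := by positivity
  linarith

/-- Among the first terms all primes are counted, after that the reciprocals are small. -/
lemma sum_inv_primeFactors_le (n : ℕ) {M : ℕ} (hM : 0 < M) :
    ∑ p ∈ n.primeFactors, 1 / (p : ℝ) ≤ M + n.primeFactors.card / M := by
  have hM' : (0 : ℝ) < M := by exact_mod_cast hM
  calc ∑ p ∈ n.primeFactors, 1 / (p : ℝ)
      ≤ ∑ p ∈ n.primeFactors, ((if p ∈ Finset.Icc 1 M then 1 else 0) + 1 / (M : ℝ)) := by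
        refine Finset.sum_le_sum fun p hp => ?_
        have hp1 := (Nat.prime_of_mem_primeFactors hp).one_le
        have hp' : (1 : ℝ) ≤ p := by exact_mod_cast hp1
        split_ifs with h
        · have : 1 / (p : ℝ) ≤ 1 := (div_le_one (by linarith)).2 hp'
          have : 0 < 1 / (M : ℝ) := by positivity
          linarith
        · rw [zero_add]
          have : M ≤ p := by
            rw [Finset.mem_Icc] at h
            omega
          gcongr
    _ = (n.primeFactors.filter (· ∈ Finset.Icc 1 M)).card + n.primeFactors.card / M := by
        rw [Finset.sum_add_distrib, Finset.sum_boole, Finset.sum_const, nsmul_eq_mul, mul_one_div]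
    _ ≤ _ := by
        gcongr
        calc _ ≤ (Finset.Icc 1 M).card := Finset.card_le_card fun p hp => (Finset.mem_filter.1 hp).2
          _ = M := by simp

end LowerBound

section CompositeSum

/-- The logarithm of the Euler factor `(1 - 1 / q)⁻¹`. -/
noncomputable def logEulerFactor (q : ℕ) : ℝ := -Real.log (1 - (q : ℝ)⁻¹)

lemma one_sub_inv_pos {q : ℕ} (hq : 2 ≤ q) : (0 : ℝ) < 1 - (q : ℝ)⁻¹ := by
  have : (1 : ℝ) < q := by exact_mod_cast hq
  have := inv_lt_one_of_one_lt₀ this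
  linarith

lemma logEulerFactor_le_one_div {q : ℕ} (hq : 2 ≤ q) : logEulerFactor q ≤ 1 / (q - 1) := by
  have h := Real.one_sub_inv_le_log_of_pos (one_sub_inv_pos hq)
  have hq' : (2 : ℝ) ≤ q := by exact_mod_cast hq
  have e : (1 - (q : ℝ)⁻¹)⁻¹ = 1 + 1 / (q - 1) := by
    have : (q : ℝ) - 1 ≠ 0 := by linarith
    field_simp
    ring
  rw [e] at h
  rw [logEulerFactor]
  linarith

lemma logEulerFactor_le_of_odd {m : ℕ} (hm : 1 ≤ m) :
    logEulerFactor (2 * m + 1) ≤ (Real.log (2 * m + 1) - Real.log (2 * m - 1)) / 2 := by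
  have hm' : (1 : ℝ) ≤ m := by exact_mod_cast hm
  have h1 : Real.log (1 - ((2 * m + 1 : ℕ) : ℝ)⁻¹) = Real.log (2 * m) - Real.log (2 * m + 1) := by
    rw [← Real.log_div (by positivity) (by positivity)]
    congr 1
    push_cast
    field_simp
    ring
  have h2 : Real.log (2 * m + 1) + Real.log (2 * m - 1) ≤ 2 * Real.log (2 * m) := by
    have : (2 : ℝ) * m - 1 > 0 := by linarith
    rw [← Real.log_mul (by positivity) (by positivity), two_mul (Real.log _),
      ← Real.log_mul (by positivity) (by positivity)]
    exact Real.log_le_log (by positivity) (by nlinarith)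
  rw [logEulerFactor, h1]
  linarith

/-- A crude form of Mertens' theorem. -/
lemma sum_logEulerFactor_le {a X : ℕ} (ha : 2 ≤ a) (haX : a ≤ X) {s : Finset ℕ}
    (hs : ∀ q ∈ s, q.Prime ∧ a ≤ q ∧ q ≤ X) :
    ∑ q ∈ s, logEulerFactor q ≤ 1 + Real.log (3 * (X + 1) / a) / 2 := by
  set g : ℕ → ℝ := fun m => (Real.log (2 * m + 1) - Real.log (2 * m - 1)) / 2 with hg
  have hg0 : ∀ m : ℕ, 1 ≤ m → 0 ≤ g m := by
    intro m hm
    have hm' : (1 : ℝ) ≤ m := by exact_mod_cast hm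
    have : Real.log (2 * m - 1) ≤ Real.log (2 * m + 1) :=
      Real.log_le_log (by linarith) (by linarith)
    simp only [hg]
    linarith
  have htel : ∀ b M : ℕ, b ≤ M →
      ∑ m ∈ Finset.Ico b M, g m = (Real.log (2 * M - 1) - Real.log (2 * b - 1)) / 2 := by
    intro b M hbM
    induction M, hbM using Nat.le_induction with
    | base => simp
    | succ M hM ih =>
      rw [Finset.sum_Ico_succ_top hM, ih]
      simp only [hg]
      push_cast
      rw [show (2 : ℝ) * (M + 1) - 1 = 2 * M + 1 by ring]
      ring
  have hodd : ∀ q ∈ s.erase 2, 2 * (q / 2) + 1 = q := by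
    intro q hq
    rw [Finset.mem_erase] at hq
    exact Nat.two_mul_div_two_add_one_of_odd ((hs q hq.2).1.odd_of_ne_two hq.1)
  have hmain : ∑ q ∈ s.erase 2, logEulerFactor q ≤ ∑ m ∈ Finset.Ico (a / 2) (X / 2 + 1), g m := by
    have hinj : Set.InjOn (fun q : ℕ => q / 2) (s.erase 2 : Finset ℕ) := by
      intro x hx y hy hxy
      rw [← hodd x hx, ← hodd y hy]
      simp only at hxy
      rw [hxy]
    calc ∑ q ∈ s.erase 2, logEulerFactor q ≤ ∑ q ∈ s.erase 2, g (q / 2) := by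
          refine Finset.sum_le_sum fun q hq => ?_
          have h2 := (hs q (Finset.mem_of_mem_erase hq)).1.two_le
          conv_lhs => rw [← hodd q hq]
          exact logEulerFactor_le_of_odd (by omega)
      _ = ∑ m ∈ (s.erase 2).image (fun q => q / 2), g m := (Finset.sum_image hinj).symm
      _ ≤ _ := by
          refine Finset.sum_le_sum_of_subset_of_nonneg (fun m hm => ?_) fun m hm _ => hg0 m ?_
          · obtain ⟨q, hq, rfl⟩ := Finset.mem_image.1 hm
            have := hs q (Finset.mem_of_mem_erase hq)
            rw [Finset.mem_Ico]
            omega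
          · rw [Finset.mem_Ico] at hm
            omega
  have htwo : ∑ q ∈ s, logEulerFactor q ≤ 1 + ∑ q ∈ s.erase 2, logEulerFactor q := by
    by_cases h : 2 ∈ s
    · rw [← Finset.add_sum_erase _ _ h]
      have := logEulerFactor_le_one_div (le_refl 2)
      norm_num at this
      linarith
    · rw [Finset.erase_eq_of_notMem h]
      linarith
  rw [htel _ _ (by omega)] at hmain
  have hb : (a : ℝ) / 3 ≤ 2 * (a / 2 : ℕ) - 1 := by
    have : a + 3 ≤ 3 * (2 * (a / 2)) := by omega
    have : (a : ℝ) + 3 ≤ 3 * (2 * (a / 2 : ℕ)) := by exact_mod_cast this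
    linarith
  have hX : (2 : ℝ) * (X / 2 + 1 : ℕ) - 1 ≤ X + 1 := by
    have : 2 * (X / 2 + 1) ≤ X + 2 := by omega
    have : (2 : ℝ) * (X / 2 + 1 : ℕ) ≤ X + 2 := by exact_mod_cast this
    linarith
  have hX0 : (0 : ℝ) < 2 * (X / 2 + 1 : ℕ) - 1 := by
    push_cast
    have : (0 : ℝ) ≤ (X / 2 : ℕ) := by positivity
    linarith
  have ha' : (0 : ℝ) < a := by exact_mod_cast (show 0 < a by omega)
  have h1 := Real.log_le_log (by positivity) hb
  have h2 := Real.log_le_log hX0 hX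
  have h3 : Real.log (3 * (X + 1) / a) = Real.log (X + 1) - Real.log (a / 3) := by
    rw [← Real.log_div (by positivity) (by positivity)]
    congr 1
    field_simp
  rw [h3]
  linarith

lemma sum_one_div_sqrt_le (Y : ℕ) : ∑ p ∈ Finset.Icc 1 Y, 1 / √(p : ℝ) ≤ 2 * √Y := by
  induction Y with
  | zero => simp
  | succ Y ih =>
    rw [Finset.sum_Icc_succ_top (by omega)]
    have h1 : 0 < √((Y + 1 : ℕ) : ℝ) := Real.sqrt_pos.2 (by positivity)
    have h2 : √((Y + 1 : ℕ) : ℝ) ^ 2 = Y + 1 := by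
      rw [Real.sq_sqrt (by positivity)]
      push_cast
      ring
    have h3 : √(Y : ℝ) ^ 2 = Y := Real.sq_sqrt (by positivity)
    have h4 : 1 / √((Y + 1 : ℕ) : ℝ) ≤ 2 * (√((Y + 1 : ℕ) : ℝ) - √Y) := by
      rw [div_le_iff₀ h1]
      nlinarith [sq_nonneg (√((Y + 1 : ℕ) : ℝ) - √Y)]
    linarith

open Nat in
lemma sum_inv_le_exp_sum_logEulerFactor {s D : Finset ℕ} (hs : ∀ q ∈ s, q.Prime)
    (hD : ∀ m ∈ D, m ∈ factoredNumbers s) :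
    ∑ m ∈ D, (m : ℝ)⁻¹ ≤ Real.exp (∑ q ∈ s, logEulerFactor q) := by
  let f : ℕ →* ℝ :=
    { toFun := fun m => (m : ℝ)⁻¹
      map_one' := by simp
      map_mul' := fun x y => by push_cast; rw [mul_inv] }
  have hf : ∀ m, f m = (m : ℝ)⁻¹ := fun m => rfl
  have h := (EulerProduct.summable_and_hasSum_factoredNumbers_prod_filter_prime_geometric (f := f)
    (fun {p} hp => by
      have : (1 : ℝ) < p := by exact_mod_cast hp.one_lt
      rw [hf, norm_inv, Real.norm_natCast]
      exact inv_lt_one_of_one_lt₀ this) s).2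
  rw [Finset.filter_true_of_mem hs] at h
  have h' := hasSum_subtype_iff_indicator.1 h
  have hprod : ∏ p ∈ s, (1 - f p)⁻¹ = Real.exp (∑ q ∈ s, logEulerFactor q) := by
    rw [Real.exp_sum]
    refine Finset.prod_congr rfl fun q hq => ?_
    rw [logEulerFactor, Real.exp_neg, Real.exp_log (one_sub_inv_pos (hs q hq).two_le), hf]
  rw [hprod] at h'
  refine le_trans (le_of_eq ?_) (sum_le_hasSum D (fun m _ => ?_) h')
  · exact Finset.sum_congr rfl fun m hm => by rw [Set.indicator_of_mem (hD m hm), hf]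
  · exact Set.indicator_nonneg (fun m _ => by rw [hf]; positivity) m

open Nat in
lemma compositeSum_le {n : ℕ} (hn : n ≠ 0) : compositeSum n ≤ ∑ p ∈ n.primeFactors,
    (Real.exp (∑ q ∈ n.primeFactors with p ≤ q, logEulerFactor q) - 1) := by
  rw [compositeSum, ← Finset.sum_filter]
  have hmaps : ∀ d ∈ n.divisors.filter (fun d => 1 < d ∧ ¬ d.Prime),
      d.minFac ∈ n.primeFactors := by
    intro d hd
    simp only [Finset.mem_filter, Nat.mem_divisors] at hd
    exact Nat.mem_primeFactors.2
      ⟨Nat.minFac_prime hd.2.1.ne', d.minFac_dvd.trans hd.1.1, hn⟩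
  rw [← Finset.sum_fiberwise_of_maps_to hmaps]
  refine Finset.sum_le_sum fun p hp => ?_
  have hpp := Nat.prime_of_mem_primeFactors hp
  set E := (n.divisors.filter (fun d => 1 < d ∧ ¬ d.Prime)).filter (fun d => d.minFac = p) with hE
  have hmem : ∀ d ∈ E, d ∣ n ∧ 1 < d ∧ ¬ d.Prime ∧ d.minFac = p ∧ p * (d / p) = d := by
    intro d hd
    simp only [hE, Finset.mem_filter, Nat.mem_divisors] at hd
    exact ⟨hd.1.1.1, hd.1.2.1, hd.1.2.2, hd.2, Nat.mul_div_cancel' (hd.2 ▸ d.minFac_dvd)⟩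
  have hinj : Set.InjOn (fun d : ℕ => d / p) E := by
    intro x hx y hy hxy
    rw [← (hmem x hx).2.2.2.2, ← (hmem y hy).2.2.2.2]
    simp only at hxy
    rw [hxy]
  have hsum : ∑ d ∈ E, (d.minFac : ℝ) / d = ∑ m ∈ E.image (fun d => d / p), (m : ℝ)⁻¹ := by
    rw [Finset.sum_image hinj]
    refine Finset.sum_congr rfl fun d hd => ?_
    obtain ⟨-, -, -, h1, h2⟩ := hmem d hd
    have : (p : ℝ) ≠ 0 := by exact_mod_cast hpp.ne_zero
    rw [h1]
    conv_lhs => rw [← h2]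
    push_cast
    rw [div_mul_cancel_left₀ this]
  have hone : 1 ∉ E.image (fun d => d / p) := by
    intro h
    obtain ⟨d, hd, h1⟩ := Finset.mem_image.1 h
    obtain ⟨-, -, h2, -, h3⟩ := hmem d hd
    rw [h1, mul_one] at h3
    exact h2 (h3 ▸ hpp)
  have := sum_inv_le_exp_sum_logEulerFactor (s := n.primeFactors.filter (fun q => p ≤ q))
    (D := insert 1 (E.image fun d => d / p))
    (fun q hq => Nat.prime_of_mem_primeFactors (Finset.mem_filter.1 hq).1) (by
      intro m hm
      rw [mem_factoredNumbers']
      intro q hq hqm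
      rcases Finset.mem_insert.1 hm with rfl | hm
      · exact absurd (Nat.dvd_one.1 hqm) hq.ne_one
      obtain ⟨d, hd, rfl⟩ := Finset.mem_image.1 hm
      obtain ⟨h1, h2, -, h3, h4⟩ := hmem d hd
      have hqd : q ∣ d := hqm.trans ⟨p, by rw [mul_comm]; exact h4.symm⟩
      rw [Finset.mem_filter, Nat.mem_primeFactors]
      exact ⟨⟨hq, hqd.trans h1, hn⟩, h3 ▸ Nat.minFac_le_of_dvd hq.two_le hqd⟩)
  rw [Finset.sum_insert hone] at this
  rw [hsum]
  simp only [Nat.cast_one, inv_one] at this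
  linarith

lemma exists_primeCounting_le {η : ℝ} (hη : 0 < η) :
    ∃ N : ℕ, ∀ X : ℕ, N ≤ X → (Nat.primeCounting X : ℝ) ≤ η * X := by
  have h1 := Chebyshev.eventually_primeCounting_le one_pos
  have h2 : ∀ᶠ x : ℝ in Filter.atTop, (Real.log 4 + 1) / η ≤ Real.log x :=
    Real.tendsto_log_atTop.eventually_ge_atTop _
  have h3 := (h1.and (h2.and (Filter.eventually_ge_atTop 2)))
  obtain ⟨N, hN⟩ := Filter.eventually_atTop.1 (tendsto_natCast_atTop_atTop.eventually h3)
  refine ⟨N, fun X hX => ?_⟩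
  obtain ⟨h4, h5, h6⟩ := hN X hX
  rw [Nat.floor_natCast] at h4
  refine h4.trans ?_
  have hlog : 0 < Real.log X := Real.log_pos (by linarith)
  rw [div_le_iff₀ hη] at h5
  rw [div_le_iff₀ hlog]
  nlinarith

lemma sum_logEulerFactor_large_le {s : Finset ℕ} {X : ℕ} (hX : 1 ≤ X) (hs : ∀ q ∈ s, X < q) :
    ∑ q ∈ s, logEulerFactor q ≤ s.card / X := by
  have hX' : (0 : ℝ) < X := by exact_mod_cast hX
  calc ∑ q ∈ s, logEulerFactor q ≤ ∑ _q ∈ s, 1 / (X : ℝ) := by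
        refine Finset.sum_le_sum fun q hq => ?_
        have h := hs q hq
        refine (logEulerFactor_le_one_div (by omega)).trans ?_
        have : (X : ℝ) + 1 ≤ q := by exact_mod_cast h
        exact one_div_le_one_div_of_le hX' (by linarith)
    _ = s.card / X := by
        rw [Finset.sum_const, nsmul_eq_mul, mul_one_div]

lemma card_le_primeCounting {s : Finset ℕ} {X : ℕ} (hs : ∀ q ∈ s, q.Prime ∧ q ≤ X) :
    s.card ≤ Nat.primeCounting X := by
  rw [Nat.primeCounting, ← Nat.primesBelow_card_eq_primeCounting']
  refine Finset.card_le_card fun q hq => ?_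
  rw [Nat.mem_primesBelow]
  exact ⟨by have := (hs q hq).2; omega, (hs q hq).1⟩

lemma exp_sub_one_le_of_small {a X : ℕ} (ha : 2 ≤ a) (haX : a ≤ X) {s : Finset ℕ}
    (hs : ∀ q ∈ s, q.Prime ∧ a ≤ q) (hcard : s.card ≤ X) :
    Real.exp (∑ q ∈ s, logEulerFactor q) - 1 ≤ 9 * √(6 * X) * (1 / √a) := by
  have ha' : (0 : ℝ) < a := by exact_mod_cast (show 0 < a by omega)
  have hX' : (2 : ℝ) ≤ X := by exact_mod_cast ha.trans haX
  have h1 := sum_logEulerFactor_le ha haX (s := s.filter (· ≤ X)) fun q hq => by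
    rw [Finset.mem_filter] at hq
    exact ⟨(hs q hq.1).1, (hs q hq.1).2, hq.2⟩
  have h2 := sum_logEulerFactor_large_le (s := s.filter (¬ · ≤ X)) (X := X) (by omega)
    fun q hq => by
      rw [Finset.mem_filter] at hq
      exact not_le.1 hq.2
  have h3 : ((s.filter (¬ · ≤ X)).card : ℝ) / X ≤ 1 := by
    rw [div_le_one (by linarith)]
    exact_mod_cast (Finset.card_filter_le _ _).trans hcard
  have h4 := Finset.sum_filter_add_sum_filter_not s (· ≤ X) logEulerFactor
  have h5 : Real.log (3 * (X + 1) / a) ≤ Real.log (6 * X / a) :=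
    Real.log_le_log (by positivity) (by
      rw [show (6 : ℝ) * X = 3 * (2 * X) by ring]
      gcongr
      linarith)
  have h6 : ∑ q ∈ s, logEulerFactor q ≤ 1 + 1 + Real.log (√(6 * X / a)) := by
    rw [Real.log_sqrt (by positivity)]
    linarith
  have h7 := Real.exp_le_exp.2 h6
  rw [Real.exp_add, Real.exp_add, Real.exp_log (Real.sqrt_pos.2 (by positivity)),
    Real.sqrt_div (by positivity)] at h7
  have h8 : Real.exp 1 * Real.exp 1 ≤ 9 := by
    have := Real.exp_one_lt_d9
    have := Real.exp_pos 1
    nlinarith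
  have h9 : 0 ≤ √(6 * X) / √(a : ℝ) := by positivity
  rw [mul_assoc, mul_one_div]
  nlinarith

lemma exp_sub_one_le_of_large {k K D p : ℕ} (hk : 1 ≤ k) (hK : 2 ≤ K) (hp : 2 ≤ p)
    (hpD : k < p * D) {s : Finset ℕ} (hs : ∀ q ∈ s, q.Prime ∧ p ≤ q) (hcard : s.card ≤ k)
    (hpi : (Nat.primeCounting (K * k) : ℝ) * (2 * D * K) ≤ k) :
    Real.exp (∑ q ∈ s, logEulerFactor q) - 1 ≤ 4 / K := by
  have hk' : (0 : ℝ) < k := by exact_mod_cast hk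
  have hK' : (2 : ℝ) ≤ K := by exact_mod_cast hK
  have hterm : ∀ q ∈ s.filter (· ≤ K * k), logEulerFactor q ≤ 2 * D / k := by
    intro q hq
    rw [Finset.mem_filter] at hq
    have hpq := (hs q hq.1).2
    refine (logEulerFactor_le_one_div (hp.trans hpq)).trans ?_
    have hq2 : (2 : ℝ) ≤ q := by exact_mod_cast hp.trans hpq
    have hqD : (k : ℝ) ≤ q * D := by
      exact_mod_cast hpD.le.trans (Nat.mul_le_mul_right D hpq)
    rw [div_le_div_iff₀ (by linarith) hk']
    have : (0 : ℝ) ≤ D := by positivity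
    nlinarith
  have h1 := Finset.sum_le_card_nsmul _ _ _ hterm
  rw [nsmul_eq_mul] at h1
  have hcount : ((s.filter (· ≤ K * k)).card : ℝ) ≤ Nat.primeCounting (K * k) := by
    refine Nat.cast_le.2 (card_le_primeCounting fun q hq => ?_)
    rw [Finset.mem_filter] at hq
    exact ⟨(hs q hq.1).1, hq.2⟩
  have h2 : ((s.filter (· ≤ K * k)).card : ℝ) * (2 * D / k) ≤ 1 / K := by
    refine (mul_le_mul_of_nonneg_right hcount (by positivity)).trans ?_
    rw [← mul_div_assoc, div_le_div_iff₀ hk' (by linarith)]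
    linarith
  have h3 := sum_logEulerFactor_large_le (s := s.filter (¬ · ≤ K * k)) (X := K * k)
    (Nat.mul_pos (by omega) hk) fun q hq => by
      rw [Finset.mem_filter] at hq
      exact not_le.1 hq.2
  have h4 : ((s.filter (¬ · ≤ K * k)).card : ℝ) / (K * k : ℕ) ≤ 1 / K := by
    have : ((s.filter (¬ · ≤ K * k)).card : ℝ) ≤ k := by
      exact_mod_cast (Finset.card_filter_le _ _).trans hcard
    push_cast
    rw [div_le_div_iff₀ (by positivity) (by linarith)]
    nlinarith
  have h5 := Finset.sum_filter_add_sum_filter_not s (· ≤ K * k) logEulerFactor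
  have h6 : ∑ q ∈ s, logEulerFactor q ≤ 2 / K := by
    rw [show (2 : ℝ) / K = 1 / K + 1 / K by ring]
    linarith
  have h7 : |(2 : ℝ) / K| = 2 / K := abs_of_nonneg (by positivity)
  have h8 := Real.abs_exp_sub_one_le (x := 2 / (K : ℝ)) (by
    rw [h7, div_le_one (by linarith)]
    exact hK')
  rw [h7] at h8
  have h9 := (abs_le.1 h8).2
  have h10 := Real.exp_le_exp.2 h6
  rw [show (4 : ℝ) / K = 2 * (2 / K) by ring]
  linarith

/-- The sum over composite divisors is negligible compared to the number of prime divisors. -/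
lemma exists_compositeSum_le {ε : ℝ} (hε : 0 < ε) : ∃ N : ℕ, ∀ n : ℕ, n ≠ 0 →
    N ≤ n.primeFactors.card → compositeSum n ≤ ε * n.primeFactors.card := by
  obtain ⟨K, hK⟩ := exists_nat_ge (max 2 (8 / ε))
  have hK2' : (2 : ℝ) ≤ K := (le_max_left _ _).trans hK
  have hK2 : 2 ≤ K := by exact_mod_cast hK2'
  have hKε : 4 / (K : ℝ) ≤ ε / 2 := by
    have := (le_max_right _ _).trans hK
    rw [div_le_iff₀ hε] at this
    rw [div_le_div_iff₀ (by linarith) two_pos]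
    linarith
  obtain ⟨D, hD⟩ := exists_nat_ge (6 * K * (36 / ε) ^ 2)
  have hD0 : (0 : ℝ) < D := lt_of_lt_of_le (by positivity) hD
  obtain ⟨N, hN⟩ := exists_primeCounting_le (η := 1 / (2 * D * K ^ 2)) (by positivity)
  refine ⟨max N 1, fun n hn hNn => (compositeSum_le hn).trans ?_⟩
  set P := n.primeFactors with hP
  set k := P.card with hk
  have hk1 : 1 ≤ k := (le_max_right _ _).trans hNn
  have hk0 : (0 : ℝ) < k := by exact_mod_cast hk1
  have hKk : N ≤ K * k := ((le_max_left _ _).trans hNn).trans (Nat.le_mul_of_pos_left _ (by omega))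
  have hprime : ∀ p ∈ P, p.Prime := fun p hp => Nat.prime_of_mem_primeFactors hp
  have hs : ∀ p, ∀ q ∈ P.filter (p ≤ ·), q.Prime ∧ p ≤ q := fun p q hq => by
    rw [Finset.mem_filter] at hq
    exact ⟨hprime q hq.1, hq.2⟩
  have hcard : ∀ p, (P.filter (p ≤ ·)).card ≤ k := fun p => Finset.card_filter_le _ _
  have hpi : (Nat.primeCounting (K * k) : ℝ) * (2 * D * K) ≤ k := by
    have h := mul_le_mul_of_nonneg_right (hN (K * k) hKk) (show (0 : ℝ) ≤ 2 * D * K by positivity)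
    refine h.trans (le_of_eq ?_)
    push_cast
    field_simp
  rw [← Finset.sum_filter_add_sum_filter_not P (fun p => p * D ≤ k)]
  have hsmall : ∑ p ∈ P with p * D ≤ k,
      (Real.exp (∑ q ∈ P with p ≤ q, logEulerFactor q) - 1) ≤ ε / 2 * k := by
    have hD1 : 0 < D := by exact_mod_cast hD0
    calc _ ≤ ∑ p ∈ P with p * D ≤ k, 9 * √(6 * (K * k : ℕ)) * (1 / √p) := by
          refine Finset.sum_le_sum fun p hp => ?_
          rw [Finset.mem_filter] at hp
          refine exp_sub_one_le_of_small (hprime p hp.1).two_le ?_ (hs p) ((hcard p).trans ?_)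
          · nlinarith [hp.2]
          · nlinarith
      _ = 9 * √(6 * (K * k : ℕ)) * ∑ p ∈ P with p * D ≤ k, 1 / √(p : ℝ) := by
          rw [Finset.mul_sum]
      _ ≤ 9 * √(6 * (K * k : ℕ)) * ∑ p ∈ Finset.Icc 1 (k / D), 1 / √(p : ℝ) := by
          refine mul_le_mul_of_nonneg_left ?_ (by positivity)
          refine Finset.sum_le_sum_of_subset_of_nonneg (fun p hp => ?_) fun p _ _ => by positivity
          rw [Finset.mem_filter] at hp
          exact Finset.mem_Icc.2 ⟨(hprime p hp.1).one_lt.le, (Nat.le_div_iff_mul_le hD1).2 hp.2⟩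
      _ ≤ 9 * √(6 * (K * k : ℕ)) * (2 * √((k : ℝ) / D)) := by
          refine mul_le_mul_of_nonneg_left ((sum_one_div_sqrt_le _).trans ?_) (by positivity)
          exact mul_le_mul_of_nonneg_left (Real.sqrt_le_sqrt Nat.cast_div_le) two_pos.le
      _ = 18 * √(6 * K * k * (k / D)) := by
          push_cast
          rw [Real.sqrt_mul (by positivity) (k / D : ℝ), mul_assoc 6]
          ring
      _ ≤ 18 * (k * ε / 36) := by
          refine mul_le_mul_of_nonneg_left (Real.sqrt_le_iff.2 ⟨by positivity, ?_⟩) (by norm_num)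
          rw [← mul_div_assoc, div_le_iff₀ hD0]
          have h := mul_le_mul_of_nonneg_left hD (show (0 : ℝ) ≤ (k * ε / 36) ^ 2 by positivity)
          refine le_trans (le_of_eq ?_) h
          field_simp
      _ = ε / 2 * k := by ring
  have hlarge : ∑ p ∈ P with ¬ p * D ≤ k,
      (Real.exp (∑ q ∈ P with p ≤ q, logEulerFactor q) - 1) ≤ ε / 2 * k := by
    refine (Finset.sum_le_card_nsmul _ _ (ε / 2) fun p hp => ?_).trans ?_
    · rw [Finset.mem_filter, not_le] at hp
      exact (exp_sub_one_le_of_large hk1 hK2 (hprime p hp.1).two_le hp.2 (hs p) (hcard p)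
        hpi).trans hKε
    · rw [nsmul_eq_mul, mul_comm]
      refine mul_le_mul_of_nonneg_left ?_ (by positivity)
      exact_mod_cast Finset.card_filter_le _ _
  linarith

end CompositeSum

theorem stmt18 (r : ℕ) (hr : 1 ≤ r) :
    ∀ ε : ℝ, 0 < ε → ∃ N : ℕ, ∀ n : ℕ, 2 ≤ n → N ≤ n.primeFactors.card →
      |bigCrossNumber (Fin r → ZMod n) / (n.primeFactors.card : ℝ) - r| < ε := by
  intro ε hε
  obtain ⟨c, hc⟩ := exists_crossNumber_le_of_isMinimalZeroSum r
  obtain ⟨N₁, hN₁⟩ := exists_compositeSum_le (ε := ε / (2 * (c + 1))) (by positivity)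
  obtain ⟨M, hM⟩ := exists_nat_gt (2 * r / ε)
  have hr' : (1 : ℝ) ≤ r := by exact_mod_cast hr
  have hM0 : (0 : ℝ) < M := lt_of_le_of_lt (by positivity) hM
  have hrM : r / (M : ℝ) < ε / 2 := by
    rw [div_lt_iff₀ hε] at hM
    rw [div_lt_div_iff₀ hM0 two_pos]
    linarith
  obtain ⟨N₂, hN₂⟩ := exists_nat_gt (2 * r * (M + 1) / ε)
  refine ⟨max N₁ N₂, fun n hn hNn => ?_⟩
  have hn0 : n ≠ 0 := by omega
  set k := n.primeFactors.card with hk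
  have hkN : 2 * r * (M + 1) < ε * k := by
    rw [div_lt_iff₀ hε] at hN₂
    have : (N₂ : ℝ) ≤ k := by exact_mod_cast (le_max_right _ _).trans hNn
    nlinarith
  have hk0 : (0 : ℝ) < k := pos_of_mul_pos_right (lt_of_le_of_lt (by positivity) hkN) hε.le
  have hcomp : c * compositeSum n ≤ ε / 2 * k := by
    refine (mul_le_mul_of_nonneg_left (hN₁ n hn0 ((le_max_left _ _).trans hNn))
      (Nat.cast_nonneg c)).trans ?_
    rw [← hk, ← mul_assoc]
    refine mul_le_mul_of_nonneg_right ?_ hk0.le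
    rw [← mul_div_assoc, div_le_div_iff₀ (by positivity) two_pos]
    nlinarith
  obtain ⟨S, hS, hSk⟩ := exists_isMinimalZeroSum_le_crossNumber r hn0
  have hupper : ∀ x ∈ {x : ℝ | ∃ S : Multiset (Fin r → ZMod n),
      IsMinimalZeroSum S ∧ crossNumber S = x}, x ≤ 1 + r * k + c * compositeSum n := by
    rintro x ⟨T, hT, rfl⟩
    exact hc n hn0 T hT
  have h1 : bigCrossNumber (Fin r → ZMod n) ≤ 1 + r * k + c * compositeSum n :=
    csSup_le ⟨_, S, hS, rfl⟩ hupper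
  have h2 : crossNumber S ≤ bigCrossNumber (Fin r → ZMod n) := le_csSup ⟨_, hupper⟩ ⟨S, hS, rfl⟩
  rw [Finset.sum_sub_distrib, Finset.sum_const, nsmul_one, ← hk] at hSk
  have h3 := mul_le_mul_of_nonneg_left (sum_inv_primeFactors_le n (M := M) (by exact_mod_cast hM0))
    (Nat.cast_nonneg (α := ℝ) r)
  rw [← hk] at h3
  have h4 : r * (k / (M : ℝ)) < ε / 2 * k := by
    rw [mul_div_left_comm, mul_comm]
    exact mul_lt_mul_of_pos_right hrM hk0
  rw [div_sub' hk0.ne', abs_div, abs_of_pos hk0, div_lt_iff₀ hk0, abs_lt]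
  constructor <;> nlinarith
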